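/- Fix δ > 0, λ ≥ 0, A > 0, L > 0, and assume λ > 0, or λ = 0 and δ ≥ 1. Let (τ*, β*) be the saddle point of φ(·,·; 1, A), α* = 1/τ* + 2λ/β*, and X(H) = max(−A, min(A, H/α*)) for H standard Gaussian. There exist constants C_{x1}, C_{x2}, C_l, C_u, C, c, γ > 0 and ε₀ ∈ (0,1), depending only on (δ, λ, A, L), such that, defining for each ε ∈ (0, ε₀) the set S° of x ∈ ℝⁿ satisfying |(1/n)‖x‖₁ − E[|X(H)|]| ≤ C_{x1}·ε³, |(1/√n)‖x‖₂ − √(δ(τ*)² − 1)| ≤ C_{x2}·ε³, and C_l·n·ε² ≤ #{i : x_i ∈ (−Lε², Lε²)} ≤ C_u·n·ε², one has for every n (with m = δn) and every s ∈ {−1,+1}^m: P[ min { P(x; 1) : ‖x‖∞ ≤ A, x ∉ S° } ≤ φ(τ*, β*; 1, A) + γ·ε⁶ ] ≤ (C/ε⁶)·exp(−c n ε¹²), where the probability is over H. -/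

import Mathlib

open MeasureTheory ProbabilityTheory Real
open scoped ENNReal NNReal

/-- The deterministic scalar function `φ(τ, β; ρ, A)`. -/
noncomputable def phiFn (δ lam ρ A τ β : ℝ) : ℝ :=
  τ * β * δ / 2 + ρ * β / (2 * τ) - β ^ 2 / 4 +
    ∫ h : ℝ,
      sInf ((fun x : ℝ => β / (2 * τ) * x ^ 2 + lam * x ^ 2 - β * h * x) '' Set.Icc (-A) A)
      ∂(gaussianReal 0 1)

/-- `(τs, βs)` is a saddle point of `max_{β ≥ 0} min_{τ > 0} φ(τ, β; ρ, A)`. -/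
def IsSaddle (δ lam ρ A τs βs : ℝ) : Prop :=
  0 < τs ∧ 0 < βs ∧
    (∀ τ : ℝ, 0 < τ → phiFn δ lam ρ A τs βs ≤ phiFn δ lam ρ A τ βs) ∧
    (∀ β : ℝ, 0 ≤ β → phiFn δ lam ρ A τs β ≤ phiFn δ lam ρ A τs βs)

/-- Law of an `m × n` random matrix with i.i.d. centered Gaussian entries of variance `1/n`. -/
noncomputable def matMeasure (m n : ℕ) : Measure (Fin m → Fin n → ℝ) :=
  Measure.pi fun _ : Fin m => Measure.pi fun _ : Fin n => gaussianReal 0 ((n : ℝ≥0))⁻¹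

/-- Matrix–vector product. -/
noncomputable def mulV {m n : ℕ} (H : Fin m → Fin n → ℝ) (x : Fin n → ℝ) : Fin m → ℝ :=
  fun k => ∑ i, H k i * x i

/-- The precoding cost `P(x; 1) = (1/n)‖Hx − s‖² + (λ/n)‖x‖²`. -/
noncomputable def cost1 (m n : ℕ) (lam : ℝ) (s : Fin m → ℝ)
    (H : Fin m → Fin n → ℝ) (x : Fin n → ℝ) : ℝ :=
  (∑ k, (mulV H x k - s k) ^ 2) / n + lam * (∑ i, (x i) ^ 2) / n

/-- `X(H) = max(−A, min(A, H/α*))` with `α* = 1/τ* + 2λ/β*`. -/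
noncomputable def Xstar (lam A τs βs h : ℝ) : ℝ :=
  max (-A) (min A (h / (1 / τs + 2 * lam / βs)))

set_option linter.unusedSectionVars false

/-- The law of a vector of i.i.d. standard Gaussian variables indexed by `ι`. -/
noncomputable abbrev stdPi (ι : Type*) [Fintype ι] : Measure (ι → ℝ) :=
  Measure.pi fun _ : ι => gaussianReal 0 1

section StandardGaussian

variable {ι κ : Type*} [Fintype ι] [Fintype κ]

lemma stdPi_measurePreserving_eval (j : ι) :
    MeasurePreserving (fun ω : ι → ℝ => ω j) (stdPi ι) (gaussianReal 0 1) :=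
  measurePreserving_eval (fun _ : ι => gaussianReal 0 1) j

lemma stdPi_measurePreserving_comp {f : κ → ι} (hf : Function.Injective f) :
    MeasurePreserving (fun ω : ι → ℝ => fun k => ω (f k)) (stdPi ι) (stdPi κ) := by
  refine ⟨by fun_prop, ?_⟩
  have h1 : iIndepFun (fun (i : ι) (ω : ι → ℝ) => ω i) (stdPi ι) :=
    iIndepFun_pi (μ := fun _ : ι => gaussianReal 0 1) (X := fun _ => id) (fun _ => aemeasurable_id)
  have h2 := h1.precomp hf
  rw [iIndepFun_iff_map_fun_eq_pi_map
    (fun i => (measurable_pi_apply (f i)).aemeasurable)] at h2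
  rw [show (fun ω : ι → ℝ => fun k => ω (f k)) = fun ω k => (fun i ω => ω i) (f k) ω from rfl]
  refine h2.trans ?_
  congr 1
  ext1 k
  exact (stdPi_measurePreserving_eval (f k)).map_eq

lemma gaussianReal_integrable_of_le {f : ℝ → ℝ} (hf : AEStronglyMeasurable f (gaussianReal 0 1))
    (C : ℝ) (h : ∀ t, |f t| ≤ C * (1 + t ^ 2)) : Integrable f (gaussianReal 0 1) := by
  have h2 : Integrable (fun t : ℝ => t ^ 2) (gaussianReal 0 1) :=
    (memLp_id_gaussianReal' 2 (by norm_num)).integrable_sq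
  exact (((integrable_const 1).add h2).const_mul C).mono' hf (ae_of_all _ h)

lemma gaussianReal_integral_sq : ∫ t, t ^ 2 ∂(gaussianReal 0 1) = 1 := by
  have h := variance_fun_id_gaussianReal (μ := 0) (v := 1)
  rw [variance_eq_integral (by fun_prop)] at h
  simpa [integral_id_gaussianReal] using h

lemma hasDerivAt_gaussianPDFReal (t : ℝ) :
    HasDerivAt (gaussianPDFReal 0 1) (-(t * gaussianPDFReal 0 1 t)) t := by
  have h : HasDerivAt (fun x : ℝ => (√(2 * π * (1 : ℝ≥0)))⁻¹ * rexp (-(x - 0) ^ 2 / (2 * (1 : ℝ≥0))))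
      ((√(2 * π * (1 : ℝ≥0)))⁻¹ * (rexp (-(t - 0) ^ 2 / (2 * (1 : ℝ≥0))) * (-t))) t := by
    refine HasDerivAt.const_mul _ (HasDerivAt.exp ?_)
    have := (((hasDerivAt_id t).sub_const 0).pow 2).neg.div_const (2 * ((1 : ℝ≥0) : ℝ))
    refine this.congr_deriv ?_
    simp
    ring
  rw [gaussianPDFReal_def]
  refine h.congr_deriv ?_
  ring

lemma gaussianReal_integral_id_mul {f f' : ℝ → ℝ} {C : ℝ} (hf' : Continuous f')
    (hd : ∀ t, HasDerivAt f (f' t) t) (hb : ∀ t, |f t| ≤ C) (hb' : ∀ t, |f' t| ≤ C) :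
    ∫ t, t * f t ∂(gaussianReal 0 1) = ∫ t, f' t ∂(gaussianReal 0 1) := by
  have hf : Continuous f := continuous_iff_continuousAt.2 fun t => (hd t).continuousAt
  have hC : 0 ≤ C := (abs_nonneg _).trans (hb 0)
  have key : ∀ q : ℝ → ℝ, Integrable q (gaussianReal 0 1) →
      Integrable (fun t => gaussianPDFReal 0 1 t * q t) := by
    intro q hq
    rw [gaussianReal_of_var_ne_zero 0 one_ne_zero,
      integrable_withDensity_iff_integrable_smul' (measurable_gaussianPDF _ _)
        (ae_of_all _ fun _ => gaussianPDF_lt_top)] at hq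
    simpa [toReal_gaussianPDF] using hq
  have i0 : Integrable f (gaussianReal 0 1) :=
    gaussianReal_integrable_of_le hf.aestronglyMeasurable C fun t => by nlinarith [hb t, sq_nonneg t]
  have i1 : Integrable (fun t => t * f t) (gaussianReal 0 1) := by
    refine gaussianReal_integrable_of_le (by fun_prop) C fun t => ?_
    rw [abs_mul]
    have : |t| ≤ 1 + t ^ 2 := by nlinarith [sq_nonneg (|t| - 1), sq_abs t]
    nlinarith [mul_le_mul this (hb t) (abs_nonneg _) (by positivity)]
  have i2 : Integrable f' (gaussianReal 0 1) :=
    gaussianReal_integrable_of_le hf'.aestronglyMeasurable C fun t => by nlinarith [hb' t, sq_nonneg t]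
  rw [integral_gaussianReal_eq_integral_smul one_ne_zero,
    integral_gaussianReal_eq_integral_smul one_ne_zero]
  have := integral_mul_deriv_eq_deriv_mul_of_integrable (u := f) (v := gaussianPDFReal 0 1)
    (u' := f') (v' := fun t => -(t * gaussianPDFReal 0 1 t)) (fun t _ => hd t)
    (fun t _ => hasDerivAt_gaussianPDFReal t)
    ((key _ i1).neg.congr (ae_of_all _ fun t => by simp only [Pi.mul_apply, Pi.neg_apply]; ring))
    ((key _ i2).congr (ae_of_all _ fun t => mul_comm _ _))
    ((key _ i0).congr (ae_of_all _ fun t => mul_comm _ _))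
  simp only [smul_eq_mul]
  have e1 : ∫ t, gaussianPDFReal 0 1 t * (t * f t) = - ∫ t, f t * -(t * gaussianPDFReal 0 1 t) := by
    rw [← integral_neg]; congr 1; ext t; ring
  rw [e1, this, neg_neg]
  congr 1; ext t; ring

variable [DecidableEq ι]

lemma stdPi_measurePreserving_update (j : ι) :
    MeasurePreserving (fun p : ℝ × (ι → ℝ) => Function.update p.2 j p.1)
      ((gaussianReal 0 1).prod (stdPi ι)) (stdPi ι) := by
  have hm : Measurable (fun p : ℝ × (ι → ℝ) => Function.update p.2 j p.1) := by
    refine measurable_pi_lambda _ fun i => ?_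
    by_cases h : i = j
    · subst h; simpa using measurable_fst
    · simp only [Function.update_of_ne h]; fun_prop
  refine ⟨hm, ?_⟩
  refine (Measure.pi_eq fun s hs => ?_).symm
  rw [Measure.map_apply hm (MeasurableSet.univ_pi hs)]
  have : (fun p : ℝ × (ι → ℝ) => Function.update p.2 j p.1) ⁻¹' (Set.univ.pi s) =
      s j ×ˢ (Set.univ.pi (Function.update s j Set.univ)) := by
    ext p
    simp only [Set.mem_preimage, Set.mem_univ_pi, Set.mem_prod]
    constructor
    · intro h
      refine ⟨by simpa using h j, fun i => ?_⟩
      by_cases hi : i = j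
      · subst hi; simp
      · simpa [hi] using h i
    · rintro ⟨h1, h2⟩ i
      by_cases hi : i = j
      · subst hi; simpa using h1
      · simpa [hi] using h2 i
  rw [this, Measure.prod_prod, Measure.pi_pi, ← Finset.mul_prod_erase _ _ (Finset.mem_univ j),
    ← Finset.mul_prod_erase Finset.univ (fun i => gaussianReal 0 1 (s i)) (Finset.mem_univ j)]
  simp only [Function.update_self, measure_univ, one_mul]
  congr 1
  refine Finset.prod_congr rfl fun i hi => ?_
  rw [Function.update_of_ne (Finset.ne_of_mem_erase hi)]

/-- Gaussian integration by parts. -/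
lemma stdPi_integral_coord_mul (j : ι) {f f' : (ι → ℝ) → ℝ} {C : ℝ} (hf : Continuous f)
    (hf' : Continuous f')
    (hd : ∀ ω t, HasDerivAt (fun t => f (Function.update ω j t)) (f' (Function.update ω j t)) t)
    (hb : ∀ ω, |f ω| ≤ C) (hb' : ∀ ω, |f' ω| ≤ C) :
    ∫ ω, ω j * f ω ∂(stdPi ι) = ∫ ω, f' ω ∂(stdPi ι) := by
  have hC : 0 ≤ C := (abs_nonneg _).trans (hb 0)
  have hmp := stdPi_measurePreserving_update (ι := ι) j
  have hcoord : Integrable (fun ω : ι → ℝ => ω j) (stdPi ι) :=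
    (stdPi_measurePreserving_eval j).integrable_comp_of_integrable (g := fun t => t)
      ((memLp_id_gaussianReal' 1 (by norm_num)).integrable le_rfl)
  have i1 : Integrable (fun ω : ι → ℝ => ω j * f ω) (stdPi ι) :=
    hcoord.mul_bdd (c := C) hf.aestronglyMeasurable (ae_of_all _ hb)
  have i2 : Integrable f' (stdPi ι) :=
    (integrable_const C).mono' hf'.aestronglyMeasurable (ae_of_all _ hb')
  rw [← hmp.map_eq, integral_map hmp.measurable.aemeasurable (by fun_prop),
    integral_map hmp.measurable.aemeasurable (by fun_prop)]
  have j1 := hmp.integrable_comp_of_integrable i1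
  have j2 := hmp.integrable_comp_of_integrable i2
  refine (integral_prod_symm _ j1).trans (Eq.trans ?_ (integral_prod_symm _ j2).symm)
  refine integral_congr_ae (ae_of_all _ fun ω => ?_)
  simp only [Function.update_self, Function.comp]
  refine gaussianReal_integral_id_mul (C := C) ?_ (fun t => hd ω t) (fun t => hb _) (fun t => hb' _)
  exact hf'.comp (by fun_prop)

end StandardGaussian

section Concentration

variable {ι : Type*} [Fintype ι]

lemma isGaussian_stdPi : IsGaussian (stdPi ι) := by
  have h1 : iIndepFun (fun (i : ι) (ω : ι → ℝ) => ω i) (stdPi ι) :=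
    iIndepFun_pi (μ := fun _ : ι => gaussianReal 0 1) (X := fun _ => id) (fun _ => aemeasurable_id)
  have h2 : ∀ i, HasGaussianLaw (fun ω : ι → ℝ => ω i) (stdPi ι) := fun i =>
    ⟨by rw [(stdPi_measurePreserving_eval i).map_eq]; infer_instance⟩
  have h3 := (h1.hasGaussianLaw h2).isGaussian_map
  rwa [show (fun (ω : ι → ℝ) (i : ι) => ω i) = id from rfl, Measure.map_id] at h3

lemma stdPi_integral_coord (j : ι) : ∫ ω, ω j ∂(stdPi ι) = 0 := by
  have h := stdPi_measurePreserving_eval (ι := ι) j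
  rw [← integral_map (φ := fun ω : ι → ℝ => ω j) (f := fun t : ℝ => t) h.measurable.aemeasurable
    (by fun_prop), h.map_eq]
  exact integral_id_gaussianReal

lemma stdPi_map_rotation (a : ℝ) :
    ((stdPi ι).prod (stdPi ι)).map (ContinuousLinearMap.rotation a) =
      (stdPi ι).prod (stdPi ι) := by
  have := isGaussian_stdPi (ι := ι)
  refine IsGaussian.map_rotation_eq_self ?_ a
  ext j
  rw [eval_integral]
  · exact stdPi_integral_coord j
  · intro i
    exact (stdPi_measurePreserving_eval i).integrable_comp_of_integrable (g := fun t => t)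
      ((memLp_id_gaussianReal' 1 (by norm_num)).integrable le_rfl)

lemma ofReal_exp_integral_le_lintegral {α : Type*} [MeasurableSpace α] {μ : Measure α}
    [IsProbabilityMeasure μ] {f : α → ℝ} (hf : Integrable f μ) :
    ENNReal.ofReal (exp (∫ x, f x ∂μ)) ≤ ∫⁻ x, ENNReal.ofReal (exp (f x)) ∂μ := by
  by_cases h : Integrable (fun x => exp (f x)) μ
  · rw [← ofReal_integral_eq_lintegral_ofReal h (ae_of_all _ fun x => (exp_pos _).le)]
    exact ENNReal.ofReal_le_ofReal (convexOn_exp.map_integral_le continuous_exp.continuousOn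
      isClosed_univ (ae_of_all _ fun _ => Set.mem_univ _) hf h)
  · have : ∫⁻ x, ENNReal.ofReal (exp (f x)) ∂μ = ∞ := by
      by_contra hne
      refine h ⟨(by fun_prop), ?_⟩
      rw [hasFiniteIntegral_iff_ofReal (ae_of_all _ fun x => (exp_pos _).le)]
      exact lt_top_iff_ne_top.2 hne
    rw [this]; exact le_top

lemma stdPi_lintegral_exp_dot (d : ι → ℝ) :
    ∫⁻ η, ENNReal.ofReal (exp (∑ j, d j * η j)) ∂(stdPi ι) =
      ENNReal.ofReal (exp ((∑ j, d j ^ 2) / 2)) := by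
  have hi : ∀ j, Integrable (fun t : ℝ => exp (d j * t)) (gaussianReal 0 1) := fun j =>
    integrable_exp_mul_gaussianReal (d j)
  have h1 : Integrable (fun η : ι → ℝ => ∏ j, exp (d j * η j)) (stdPi ι) :=
    Integrable.fintype_prod (f := fun j t => exp (d j * t)) hi
  have h2 : ∫ η, ∏ j, exp (d j * η j) ∂(stdPi ι) = ∏ j, exp (d j ^ 2 / 2) := by
    rw [integral_fintype_prod_eq_prod (f := fun j t => exp (d j * t))]
    refine Finset.prod_congr rfl fun j _ => ?_
    have := congrFun (mgf_fun_id_gaussianReal (μ := 0) (v := 1)) (d j)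
    simpa [mgf] using this
  simp_rw [exp_sum]
  rw [← ofReal_integral_eq_lintegral_ofReal h1
    (ae_of_all _ fun x => Finset.prod_nonneg fun _ _ => (exp_pos _).le), h2, Finset.sum_div, exp_sum]

/-- The Maurey–Pisier exponential moment bound. -/
lemma stdPi_lintegral_exp_sub_le {F : (ι → ℝ) → ℝ} {D : (ι → ℝ) → ι → ℝ} {V : ℝ}
    (hF : ∀ (c : ℝ → ι → ℝ) (c' : ι → ℝ) (a : ℝ), (∀ j, HasDerivAt (fun t => c t j) (c' j) a) →
      HasDerivAt (fun t => F (c t)) (∑ j, D (c a) j * c' j) a)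
    (hFc : Continuous F) (hD : Continuous D) (hV : ∀ ω, ∑ j, D ω j ^ 2 ≤ V) (θ : ℝ) :
    ∫⁻ ξ, ∫⁻ η, ENNReal.ofReal (exp (θ * (F η - F ξ))) ∂(stdPi ι) ∂(stdPi ι) ≤
      ENNReal.ofReal (exp (θ ^ 2 * π ^ 2 * V / 8)) := by
  have hDj : ∀ j, Continuous fun ω => D ω j := fun j => (continuous_apply j).comp hD
  let G : ℝ → (ι → ℝ) × (ι → ℝ) → ℝ := fun a p =>
    ∑ j, (θ * (π / 2) * D p.1 j) * p.2 j
  let R : ℝ → (ι → ℝ) × (ι → ℝ) → (ι → ℝ) × (ι → ℝ) := fun s p =>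
    ContinuousLinearMap.rotation (π / 2 * s) p
  have hR : ∀ s p, R s p = (cos (π / 2 * s) • p.1 + sin (π / 2 * s) • p.2,
    -sin (π / 2 * s) • p.1 + cos (π / 2 * s) • p.2) := fun s p => rfl
  have hRc : Continuous fun q : ℝ × ((ι → ℝ) × (ι → ℝ)) => R q.1 q.2 := by
    simp only [hR]; fun_prop
  have hGc : Continuous fun q : ℝ × ((ι → ℝ) × (ι → ℝ)) => G 0 (R q.1 q.2) := by
    refine Continuous.comp (g := G 0) ?_ hRc
    refine continuous_finsetSum _ fun j _ => ?_
    have h1 : Continuous fun p : (ι → ℝ) × (ι → ℝ) => D p.1 j := (hDj j).comp continuous_fst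
    have h2 : Continuous fun p : (ι → ℝ) × (ι → ℝ) => p.2 j :=
      (continuous_apply j).comp continuous_snd
    exact (continuous_const.mul h1).mul h2
  have hGs : ∀ p, Continuous fun s => G 0 (R s p) := by
    intro p
    have h : Continuous fun s : ℝ => (s, p) := by fun_prop
    have h' := Continuous.comp hGc h
    simpa only [Function.comp_def] using h'
  have hftc : ∀ p : (ι → ℝ) × (ι → ℝ), θ * (F p.2 - F p.1) = ∫ s in (0:ℝ)..1, G 0 (R s p) := by
    intro p
    have hd : ∀ s : ℝ, HasDerivAt (fun s => θ * F (R s p).1) (G 0 (R s p)) s := by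
      intro s
      have := (hF (fun s => (R s p).1) (fun j => π / 2 * (R s p).2 j) s ?_).const_mul θ
      · refine this.congr_deriv ?_
        simp only [G, Finset.mul_sum]
        exact Finset.sum_congr rfl fun j _ => by ring
      · intro j
        have e : HasDerivAt (fun s : ℝ => π / 2 * s) (π / 2) s := by
          simpa using (hasDerivAt_id s).const_mul (π / 2)
        have := (e.cos.mul_const (p.1 j)).add (e.sin.mul_const (p.2 j))
        simp only [hR, Pi.add_apply, Pi.smul_apply, smul_eq_mul]
        refine this.congr_deriv ?_
        ring
    rw [intervalIntegral.integral_eq_sub_of_hasDerivAt (fun s _ => hd s)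
      ((hGs p).intervalIntegrable _ _)]
    simp [hR, mul_sub]
  have hjen : ∀ p : (ι → ℝ) × (ι → ℝ), ENNReal.ofReal (exp (θ * (F p.2 - F p.1))) ≤
      ∫⁻ s, ENNReal.ofReal (exp (G 0 (R s p))) ∂(volume.restrict (Set.Ioc (0:ℝ) 1)) := by
    intro p
    have : IsProbabilityMeasure (volume.restrict (Set.Ioc (0:ℝ) 1)) := ⟨by simp⟩
    rw [hftc p, intervalIntegral.integral_of_le zero_le_one]
    exact ofReal_exp_integral_le_lintegral ((hGs p).integrableOn_Ioc)
  have hcm : Continuous fun p : (ι → ℝ) × (ι → ℝ) => ENNReal.ofReal (exp (θ * (F p.2 - F p.1))) :=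
    ENNReal.continuous_ofReal.comp (by fun_prop)
  have hGm : Measurable fun q : ((ι → ℝ) × (ι → ℝ)) × ℝ =>
      ENNReal.ofReal (exp (G 0 (R q.2 q.1))) := by
    have := Continuous.comp hGc (continuous_swap (X := (ι → ℝ) × (ι → ℝ)) (Y := ℝ))
    simp only [Function.comp_def, Prod.fst_swap, Prod.snd_swap] at this
    exact (ENNReal.continuous_ofReal.comp (continuous_exp.comp this)).measurable
  have hG0 : Measurable fun p => ENNReal.ofReal (exp (G 0 p)) := by
    have : Continuous (G 0) := by
      have h : Continuous fun p : (ι → ℝ) × (ι → ℝ) => ((0:ℝ), p) := by fun_prop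
      refine (Continuous.comp hGc h).congr fun p => ?_
      simp [hR]
    exact (ENNReal.continuous_ofReal.comp (continuous_exp.comp this)).measurable
  rw [← lintegral_prod (μ := stdPi ι) (ν := stdPi ι)
    (fun p : (ι → ℝ) × (ι → ℝ) => ENNReal.ofReal (exp (θ * (F p.2 - F p.1))))
    hcm.measurable.aemeasurable]
  calc _ ≤ ∫⁻ p, ∫⁻ s, ENNReal.ofReal (exp (G 0 (R s p))) ∂(volume.restrict (Set.Ioc (0:ℝ) 1))
          ∂((stdPi ι).prod (stdPi ι)) := lintegral_mono hjen
    _ = ∫⁻ s, ∫⁻ p, ENNReal.ofReal (exp (G 0 (R s p))) ∂((stdPi ι).prod (stdPi ι))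
          ∂(volume.restrict (Set.Ioc (0:ℝ) 1)) := lintegral_lintegral_swap hGm.aemeasurable
    _ ≤ ∫⁻ _, ENNReal.ofReal (exp (θ ^ 2 * π ^ 2 * V / 8))
          ∂(volume.restrict (Set.Ioc (0:ℝ) 1)) := by
        refine lintegral_mono fun s => ?_
        have hmp : MeasurePreserving (R s) ((stdPi ι).prod (stdPi ι)) ((stdPi ι).prod (stdPi ι)) :=
          ⟨(ContinuousLinearMap.continuous _).measurable, stdPi_map_rotation _⟩
        rw [hmp.lintegral_comp hG0, lintegral_prod _ hG0.aemeasurable]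
        calc _ ≤ ∫⁻ _, ENNReal.ofReal (exp (θ ^ 2 * π ^ 2 * V / 8)) ∂(stdPi ι) := by
              refine lintegral_mono fun ξ => ?_
              simp only [G]
              rw [stdPi_lintegral_exp_dot]
              refine ENNReal.ofReal_le_ofReal (exp_le_exp.2 ?_)
              simp_rw [mul_pow]
              rw [← Finset.mul_sum]
              have := mul_le_mul_of_nonneg_left (hV ξ) (by positivity : 0 ≤ θ ^ 2 * π ^ 2 / 8)
              linarith
          _ = _ := by simp
    _ = _ := by simp

/-- Gaussian concentration (lower tail) for a function with bounded gradient. -/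
theorem stdPi_lower_tail {F : (ι → ℝ) → ℝ} {D : (ι → ℝ) → ι → ℝ} {V : ℝ}
    (hF : ∀ (c : ℝ → ι → ℝ) (c' : ι → ℝ) (a : ℝ), (∀ j, HasDerivAt (fun t => c t j) (c' j) a) →
      HasDerivAt (fun t => F (c t)) (∑ j, D (c a) j * c' j) a)
    (hFc : Continuous F) (hFi : Integrable F (stdPi ι)) (hD : Continuous D)
    (hV : ∀ ω, ∑ j, D ω j ^ 2 ≤ V) (hV0 : 0 < V) {t : ℝ} (ht : 0 ≤ t) :
    stdPi ι {ω | F ω ≤ ∫ η, F η ∂(stdPi ι) - t} ≤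
      ENNReal.ofReal (exp (-(2 * t ^ 2 / (π ^ 2 * V)))) := by
  set θ : ℝ := 4 * t / (π ^ 2 * V) with hθ
  have hθ0 : 0 ≤ θ := by positivity
  have hmain := stdPi_lintegral_exp_sub_le hF hFc hD hV θ
  have hm : Measurable fun ξ => ∫⁻ η, ENNReal.ofReal (exp (θ * (F η - F ξ))) ∂(stdPi ι) := by
    have h : Measurable fun p : (ι → ℝ) × (ι → ℝ) => ENNReal.ofReal (exp (θ * (F p.2 - F p.1))) :=
      (ENNReal.continuous_ofReal.comp (by fun_prop)).measurable
    exact h.lintegral_prod_right'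
  have hsub : {ω | F ω ≤ ∫ η, F η ∂(stdPi ι) - t} ⊆
      {ξ | ENNReal.ofReal (exp (θ * t)) ≤
        ∫⁻ η, ENNReal.ofReal (exp (θ * (F η - F ξ))) ∂(stdPi ι)} := by
    intro ξ hξ
    simp only [Set.mem_ofPred_eq] at hξ ⊢
    have hi : Integrable (fun η => θ * (F η - F ξ)) (stdPi ι) :=
      (hFi.sub (integrable_const _)).const_mul θ
    refine le_trans (ENNReal.ofReal_le_ofReal (exp_le_exp.2 ?_))
      (ofReal_exp_integral_le_lintegral hi)
    rw [integral_const_mul, integral_sub hFi (integrable_const _)]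
    simp only [integral_const, probReal_univ, smul_eq_mul, one_mul]
    exact mul_le_mul_of_nonneg_left (by linarith) hθ0
  refine (measure_mono hsub).trans ?_
  refine (meas_ge_le_lintegral_div hm.aemeasurable (by simpa using exp_pos _)
    ENNReal.ofReal_ne_top).trans ?_
  refine (ENNReal.div_le_div_right hmain _).trans ?_
  rw [← ENNReal.ofReal_div_of_pos (exp_pos _), ← exp_sub]
  refine ENNReal.ofReal_le_ofReal (exp_le_exp.2 (le_of_eq ?_))
  rw [hθ]
  field_simp
  ring

end Concentration

section SoftMin

variable {κ J ι : Type*} [Fintype κ] [Fintype J] [Fintype ι]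

/-- The smooth minimum of a finite family. -/
noncomputable def softMin (k : ℝ) (M : κ → ℝ) : ℝ := -(log (∑ x, exp (-k * M x))) / k

/-- The Gibbs weights, i.e. the gradient of `softMin`. -/
noncomputable def gibbs (k : ℝ) (M : κ → ℝ) (x : κ) : ℝ := exp (-k * M x) / ∑ y, exp (-k * M y)

/-- A smooth upper approximation of the Euclidean norm. -/
noncomputable def smoothNorm (v : J → ℝ) : ℝ := √(∑ l, v l ^ 2 + 1)

lemma smoothNorm_arg_pos (v : J → ℝ) : 0 < ∑ l, v l ^ 2 + 1 := by positivity

lemma smoothNorm_pos (v : J → ℝ) : 0 < smoothNorm v := sqrt_pos.2 (smoothNorm_arg_pos v)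

lemma one_le_smoothNorm (v : J → ℝ) : 1 ≤ smoothNorm v :=
  Real.one_le_sqrt.2 (by have : 0 ≤ ∑ l, v l ^ 2 := by positivity
                         linarith)

lemma smoothNorm_sq (v : J → ℝ) : smoothNorm v ^ 2 = ∑ l, v l ^ 2 + 1 :=
  sq_sqrt (smoothNorm_arg_pos v).le

lemma sqrt_le_smoothNorm (v : J → ℝ) : √(∑ l, v l ^ 2) ≤ smoothNorm v :=
  sqrt_le_sqrt (by linarith)

lemma smoothNorm_le (v : J → ℝ) : smoothNorm v ≤ √(∑ l, v l ^ 2) + 1 := by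
  refine Real.sqrt_le_iff.2 ⟨by positivity, ?_⟩
  have h : √(∑ l, v l ^ 2) ^ 2 = ∑ l, v l ^ 2 := sq_sqrt (by positivity)
  nlinarith [sqrt_nonneg (∑ l, v l ^ 2)]

lemma sum_sq_div_smoothNorm_le (v : J → ℝ) : ∑ l, (v l / smoothNorm v) ^ 2 ≤ 1 := by
  simp_rw [div_pow]
  rw [← Finset.sum_div, smoothNorm_sq, div_le_one (smoothNorm_arg_pos v)]
  linarith

lemma abs_div_smoothNorm_le (v : J → ℝ) (l : J) : |v l / smoothNorm v| ≤ 1 := by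
  rw [abs_le_one_iff_mul_self_le_one, ← sq]
  exact (Finset.single_le_sum (f := fun l => (v l / smoothNorm v) ^ 2)
    (fun _ _ => sq_nonneg _) (Finset.mem_univ l)).trans (sum_sq_div_smoothNorm_le v)

lemma continuous_smoothNorm : Continuous (smoothNorm : (J → ℝ) → ℝ) := by
  unfold smoothNorm; fun_prop

lemma hasDerivAt_smoothNorm {v : ℝ → J → ℝ} {v' : J → ℝ} {a : ℝ}
    (h : ∀ l, HasDerivAt (fun t => v t l) (v' l) a) :
    HasDerivAt (fun t => smoothNorm (v t)) (∑ l, v a l / smoothNorm (v a) * v' l) a := by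
  have h1 : HasDerivAt (fun t => ∑ l, v t l ^ 2 + 1) (∑ l, 2 * v a l * v' l) a := by
    refine (HasDerivAt.fun_sum fun l _ => ?_).add_const 1
    refine ((h l).fun_pow 2).congr_deriv ?_
    norm_num
  refine (h1.sqrt (smoothNorm_arg_pos _).ne').congr_deriv ?_
  have hp := smoothNorm_pos (v a)
  change _ / (2 * smoothNorm (v a)) = _
  rw [Finset.sum_div]
  refine Finset.sum_congr rfl fun l _ => ?_
  field_simp

lemma hasDerivAt_div_smoothNorm {v : ℝ → J → ℝ} {v' : J → ℝ} {a : ℝ}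
    (h : ∀ l, HasDerivAt (fun t => v t l) (v' l) a) (i : J) :
    HasDerivAt (fun t => v t i / smoothNorm (v t))
      (v' i / smoothNorm (v a) - v a i / smoothNorm (v a) *
        (∑ l, v a l / smoothNorm (v a) * v' l) / smoothNorm (v a)) a := by
  have hp := smoothNorm_pos (v a)
  refine ((h i).fun_div (hasDerivAt_smoothNorm h) hp.ne').congr_deriv ?_
  field_simp

lemma gibbs_nonneg (k : ℝ) (M : κ → ℝ) (x : κ) : 0 ≤ gibbs k M x := by
  unfold gibbs; positivity

lemma sum_exp_pos [Nonempty κ] (k : ℝ) (M : κ → ℝ) : 0 < ∑ y, exp (-k * M y) := by positivity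

lemma sum_gibbs [Nonempty κ] (k : ℝ) (M : κ → ℝ) : ∑ x, gibbs k M x = 1 := by
  unfold gibbs
  rw [← Finset.sum_div, div_self (sum_exp_pos k M).ne']

lemma gibbs_le_one [Nonempty κ] (k : ℝ) (M : κ → ℝ) (x : κ) : gibbs k M x ≤ 1 := by
  rw [← sum_gibbs k M]
  exact Finset.single_le_sum (fun x _ => gibbs_nonneg k M x) (Finset.mem_univ x)

lemma continuous_gibbs [Nonempty κ] (k : ℝ) (x : κ) : Continuous fun M : κ → ℝ => gibbs k M x := by
  unfold gibbs
  exact Continuous.div (by fun_prop) (by fun_prop) fun M => (sum_exp_pos k M).ne'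

lemma continuous_softMin [Nonempty κ] (k : ℝ) : Continuous fun M : κ → ℝ => softMin k M := by
  unfold softMin
  exact ((Continuous.log (by fun_prop) fun M => (sum_exp_pos k M).ne').neg).div_const k

lemma hasDerivAt_sum_exp {k : ℝ} {M : ℝ → κ → ℝ} {M' : κ → ℝ} {a : ℝ}
    (h : ∀ x, HasDerivAt (fun t => M t x) (M' x) a) :
    HasDerivAt (fun t => ∑ x, exp (-k * M t x)) (∑ x, exp (-k * M a x) * (-k * M' x)) a :=
  HasDerivAt.fun_sum fun x _ => ((h x).const_mul (-k)).exp

lemma hasDerivAt_softMin [Nonempty κ] {k : ℝ} (hk : 0 < k) {M : ℝ → κ → ℝ} {M' : κ → ℝ} {a : ℝ}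
    (h : ∀ x, HasDerivAt (fun t => M t x) (M' x) a) :
    HasDerivAt (fun t => softMin k (M t)) (∑ x, gibbs k (M a) x * M' x) a := by
  have h1 := (((hasDerivAt_sum_exp (k := k) h).log (sum_exp_pos k (M a)).ne').fun_neg).div_const k
  refine h1.congr_deriv ?_
  have := (sum_exp_pos k (M a)).ne'
  simp only [gibbs]
  rw [Finset.sum_div, ← Finset.sum_neg_distrib, Finset.sum_div]
  refine Finset.sum_congr rfl fun x _ => ?_
  field_simp

lemma hasDerivAt_gibbs [Nonempty κ] {k : ℝ} {M : ℝ → κ → ℝ} {M' : κ → ℝ} {a : ℝ}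
    (h : ∀ x, HasDerivAt (fun t => M t x) (M' x) a) (x : κ) :
    HasDerivAt (fun t => gibbs k (M t) x)
      (-k * gibbs k (M a) x * (M' x - ∑ y, gibbs k (M a) y * M' y)) a := by
  have h1 := (((h x).const_mul (-k)).exp).fun_div (hasDerivAt_sum_exp (k := k) h)
    (sum_exp_pos k (M a)).ne'
  refine h1.congr_deriv ?_
  have hp := (sum_exp_pos k (M a)).ne'
  have e : ∑ y, gibbs k (M a) y * M' y = (∑ y, exp (-k * M a y) * M' y) /
      ∑ y, exp (-k * M a y) := by
    rw [Finset.sum_div]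
    exact Finset.sum_congr rfl fun y _ => by simp only [gibbs]; ring
  have e2 : ∑ y, exp (-k * M a y) * (-k * M' y) = -k * ∑ y, exp (-k * M a y) * M' y := by
    rw [Finset.mul_sum]
    exact Finset.sum_congr rfl fun y _ => by ring
  rw [e, e2]
  simp only [gibbs]
  field_simp
  ring

lemma softMin_le [Nonempty κ] {k : ℝ} (hk : 0 < k) (M : κ → ℝ) (x : κ) : softMin k M ≤ M x := by
  unfold softMin
  rw [div_le_iff₀ hk, neg_le]
  have h : exp (-k * M x) ≤ ∑ y, exp (-k * M y) :=
    Finset.single_le_sum (f := fun y => exp (-k * M y)) (fun _ _ => (exp_pos _).le)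
      (Finset.mem_univ x)
  have := (le_log_iff_exp_le (sum_exp_pos k M)).2 h
  linarith

lemma le_softMin [Nonempty κ] {k : ℝ} (hk : 0 < k) {M : κ → ℝ} {c : ℝ} (h : ∀ x, c ≤ M x) :
    c - log (Fintype.card κ) / k ≤ softMin k M := by
  unfold softMin
  rw [← sub_nonneg]
  have hc : (0 : ℝ) < Fintype.card κ := by exact_mod_cast Fintype.card_pos
  have h1 : ∑ y, exp (-k * M y) ≤ Fintype.card κ * exp (-k * c) := by
    have := Finset.sum_le_card_nsmul Finset.univ (fun y => exp (-k * M y)) (exp (-k * c))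
      fun y _ => exp_le_exp.2 (by nlinarith [h y])
    simpa using this
  have h2 := log_le_log (sum_exp_pos k M) h1
  rw [log_mul hc.ne' (exp_pos _).ne', log_exp] at h2
  have : -log (∑ y, exp (-k * M y)) / k - (c - log (Fintype.card κ) / k) =
      (log (Fintype.card κ) + -k * c - log (∑ y, exp (-k * M y))) / k := by
    field_simp; ring
  rw [this]
  exact div_nonneg (by linarith) hk.le

/-- The energies `b (‖V x‖ + w x) + ψ x`. -/
noncomputable def energy (b : ℝ) (ψ : κ → ℝ) (V : κ → J → ℝ) (w : κ → ℝ) (x : κ) : ℝ :=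
  b * (smoothNorm (V x) + w x) + ψ x

lemma hasDerivAt_energy {b : ℝ} {ψ : κ → ℝ} {V : ℝ → κ → J → ℝ} {w : ℝ → κ → ℝ}
    {V' : κ → J → ℝ} {w' : κ → ℝ} {a : ℝ} (hV : ∀ x l, HasDerivAt (fun t => V t x l) (V' x l) a)
    (hw : ∀ x, HasDerivAt (fun t => w t x) (w' x) a) (x : κ) :
    HasDerivAt (fun t => energy b ψ (V t) (w t) x)
      (b * (∑ l, V a x l / smoothNorm (V a x) * V' x l + w' x)) a :=
  (((hasDerivAt_smoothNorm (v := fun t => V t x) (hV x)).add (hw x)).const_mul b).add_const (ψ x)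

/-- An affine random field, evaluated at `ω`. -/
def affField (A : κ → J → ι → ℝ) (s : J → ℝ) (ω : ι → ℝ) (x : κ) (l : J) : ℝ :=
  ∑ j, A x l j * ω j - s l

/-- A linear random field, evaluated at `ω`. -/
def linField (B : κ → ι → ℝ) (ω : ι → ℝ) (x : κ) : ℝ := ∑ j, B x j * ω j

/-- The smooth min-max functional of a pair of Gaussian fields. -/
noncomputable def minMax (k b : ℝ) (ψ : κ → ℝ) (s : J → ℝ) (A : κ → J → ι → ℝ) (B : κ → ι → ℝ)
    (ω : ι → ℝ) : ℝ := softMin k (energy b ψ (affField A s ω) (linField B ω))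

lemma continuous_energy_field {b : ℝ} {ψ : κ → ℝ} {s : J → ℝ} {A : κ → J → ι → ℝ} {B : κ → ι → ℝ} :
    Continuous fun ω => energy b ψ (affField A s ω) (linField B ω) := by
  refine continuous_pi fun x => ?_
  simp only [energy, affField, linField, smoothNorm]
  fun_prop

lemma continuous_div_field {s : J → ℝ} {A : κ → J → ι → ℝ} (x : κ) (l : J) :
    Continuous fun ω => affField A s ω x l / smoothNorm (affField A s ω x) := by
  refine Continuous.div ?_ ?_ fun ω => (smoothNorm_pos _).ne'
  · simp only [affField]; fun_prop
  · simp only [affField, smoothNorm]; fun_prop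

lemma continuous_minMax [Nonempty κ] {k b : ℝ} {ψ : κ → ℝ} {s : J → ℝ} {A : κ → J → ι → ℝ}
    {B : κ → ι → ℝ} : Continuous (minMax k b ψ s A B) :=
  (continuous_softMin k).comp continuous_energy_field

end SoftMin

section BoundedFun

/-- Boundedness of a real function. -/
def BoundedFun {α : Type*} (f : α → ℝ) : Prop := ∃ C, ∀ x, |f x| ≤ C

variable {α : Type*}

lemma BoundedFun.const (c : ℝ) : BoundedFun fun _ : α => c := ⟨|c|, fun _ => le_rfl⟩

lemma BoundedFun.add {f g : α → ℝ} (hf : BoundedFun f) (hg : BoundedFun g) :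
    BoundedFun fun x => f x + g x := by
  obtain ⟨C, hC⟩ := hf
  obtain ⟨D, hD⟩ := hg
  exact ⟨C + D, fun x => (abs_add_le _ _).trans (add_le_add (hC x) (hD x))⟩

lemma BoundedFun.mul {f g : α → ℝ} (hf : BoundedFun f) (hg : BoundedFun g) :
    BoundedFun fun x => f x * g x := by
  obtain ⟨C, hC⟩ := hf
  obtain ⟨D, hD⟩ := hg
  refine ⟨C * D, fun x => ?_⟩
  rw [abs_mul]
  exact mul_le_mul (hC x) (hD x) (abs_nonneg _) ((abs_nonneg _).trans (hC x))

lemma BoundedFun.neg {f : α → ℝ} (hf : BoundedFun f) : BoundedFun fun x => -f x := by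
  obtain ⟨C, hC⟩ := hf
  exact ⟨C, fun x => by rw [abs_neg]; exact hC x⟩

lemma BoundedFun.sub {f g : α → ℝ} (hf : BoundedFun f) (hg : BoundedFun g) :
    BoundedFun fun x => f x - g x := by
  simpa only [sub_eq_add_neg] using hf.add hg.neg

lemma BoundedFun.sum {σ : Type*} [Fintype σ] {f : σ → α → ℝ} (hf : ∀ i, BoundedFun (f i)) :
    BoundedFun fun x => ∑ i, f i x := by
  choose C hC using hf
  exact ⟨∑ i, C i, fun x => (Finset.abs_sum_le_sum_abs _ _).trans
    (Finset.sum_le_sum fun i _ => hC i x)⟩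

end BoundedFun

section Directional

variable {κ J ι : Type*} [Fintype κ] [Fintype J] [Fintype ι]

/-- The unit direction of an affine field. -/
noncomputable def dirField (A : κ → J → ι → ℝ) (s : J → ℝ) (ω : ι → ℝ) (x : κ) (l : J) : ℝ :=
  affField A s ω x l / smoothNorm (affField A s ω x)

/-- The directional slope of the energy at `x` along the pair `(dA, dB)`. -/
noncomputable def slopeField (b : ℝ) (s : J → ℝ) (A dA : κ → J → ι → ℝ) (dB : κ → ι → ℝ)
    (ω : ι → ℝ) (x : κ) (j : ι) : ℝ :=
  b * (∑ l, dirField A s ω x l * dA x l j + dB x j)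

/-- The Gibbs weights of the energy. -/
noncomputable def weight (k b : ℝ) (ψ : κ → ℝ) (s : J → ℝ) (A : κ → J → ι → ℝ) (B : κ → ι → ℝ)
    (ω : ι → ℝ) (x : κ) : ℝ := gibbs k (energy b ψ (affField A s ω) (linField B ω)) x

/-- The Gibbs average of the slopes. -/
noncomputable def meanSlope (k b : ℝ) (ψ : κ → ℝ) (s : J → ℝ) (A : κ → J → ι → ℝ) (B : κ → ι → ℝ)
    (dA : κ → J → ι → ℝ) (dB : κ → ι → ℝ) (ω : ι → ℝ) (j : ι) : ℝ :=
  ∑ x, weight k b ψ s A B ω x * slopeField b s A dA dB ω x j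

/-- The partial derivative of `meanSlope` in its own coordinate. -/
noncomputable def meanSlopeDeriv (k b : ℝ) (ψ : κ → ℝ) (s : J → ℝ) (A : κ → J → ι → ℝ)
    (B : κ → ι → ℝ) (dA : κ → J → ι → ℝ) (dB : κ → ι → ℝ) (ω : ι → ℝ) (j : ι) : ℝ :=
  ∑ x, (-k * weight k b ψ s A B ω x * (slopeField b s A A B ω x j -
      ∑ y, weight k b ψ s A B ω y * slopeField b s A A B ω y j) * slopeField b s A dA dB ω x j +
    weight k b ψ s A B ω x * (b * ∑ l, (A x l j / smoothNorm (affField A s ω x) -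
      dirField A s ω x l * (∑ i, dirField A s ω x i * A x i j) /
        smoothNorm (affField A s ω x)) * dA x l j))

variable {k b : ℝ} {ψ : κ → ℝ} {s : J → ℝ}

lemma hasDerivAt_affField_comp {A : κ → J → ι → ℝ} {c : ℝ → ι → ℝ} {c' : ι → ℝ} {a : ℝ}
    (h : ∀ j, HasDerivAt (fun t => c t j) (c' j) a) (x : κ) (l : J) :
    HasDerivAt (fun t => affField A s (c t) x l) (∑ j, A x l j * c' j) a :=
  (HasDerivAt.fun_sum fun j _ => (h j).const_mul (A x l j)).sub_const (s l)

lemma hasDerivAt_linField_comp {B : κ → ι → ℝ} {c : ℝ → ι → ℝ} {c' : ι → ℝ} {a : ℝ}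
    (h : ∀ j, HasDerivAt (fun t => c t j) (c' j) a) (x : κ) :
    HasDerivAt (fun t => linField B (c t) x) (∑ j, B x j * c' j) a :=
  HasDerivAt.fun_sum fun j _ => (h j).const_mul (B x j)

lemma slope_sum (A dA : κ → J → ι → ℝ) (dB : κ → ι → ℝ) (ω c : ι → ℝ) (x : κ) :
    b * (∑ l, dirField A s ω x l * (∑ j, dA x l j * c j) + ∑ j, dB x j * c j) =
      ∑ j, slopeField b s A dA dB ω x j * c j := by
  simp only [slopeField, Finset.mul_sum, mul_add, add_mul, Finset.sum_mul, Finset.sum_add_distrib]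
  rw [Finset.sum_comm]
  congr 1
  · exact Finset.sum_congr rfl fun _ _ => Finset.sum_congr rfl fun _ _ => by ring
  · exact Finset.sum_congr rfl fun _ _ => by ring

lemma hasDerivAt_energy_comp {A : κ → J → ι → ℝ} {B : κ → ι → ℝ} {c : ℝ → ι → ℝ} {c' : ι → ℝ}
    {a : ℝ} (h : ∀ j, HasDerivAt (fun t => c t j) (c' j) a) (x : κ) :
    HasDerivAt (fun t => energy b ψ (affField A s (c t)) (linField B (c t)) x)
      (∑ j, slopeField b s A A B (c a) x j * c' j) a :=
  (hasDerivAt_energy (V := fun t => affField A s (c t)) (w := fun t => linField B (c t))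
    (hasDerivAt_affField_comp h) (hasDerivAt_linField_comp h) x).congr_deriv
    (slope_sum A A B (c a) c' x)

lemma hasDerivAt_minMax_comp [Nonempty κ] (hk : 0 < k) {A : κ → J → ι → ℝ} {B : κ → ι → ℝ}
    (c : ℝ → ι → ℝ) (c' : ι → ℝ) (a : ℝ) (h : ∀ j, HasDerivAt (fun t => c t j) (c' j) a) :
    HasDerivAt (fun t => minMax k b ψ s A B (c t))
      (∑ j, meanSlope k b ψ s A B A B (c a) j * c' j) a := by
  refine (hasDerivAt_softMin hk (M := fun t => energy b ψ (affField A s (c t)) (linField B (c t)))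
    (hasDerivAt_energy_comp h)).congr_deriv ?_
  simp only [meanSlope, weight, Finset.mul_sum, Finset.sum_mul]
  rw [Finset.sum_comm]
  exact Finset.sum_congr rfl fun _ _ => Finset.sum_congr rfl fun _ _ => by ring

lemma hasDerivAt_minMax_param [Nonempty κ] (hk : 0 < k) {A : ℝ → κ → J → ι → ℝ}
    {B : ℝ → κ → ι → ℝ} {dA : κ → J → ι → ℝ} {dB : κ → ι → ℝ} {a : ℝ}
    (hA : ∀ x l j, HasDerivAt (fun t => A t x l j) (dA x l j) a)
    (hB : ∀ x j, HasDerivAt (fun t => B t x j) (dB x j) a) (ω : ι → ℝ) :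
    HasDerivAt (fun t => minMax k b ψ s (A t) (B t) ω)
      (∑ j, ω j * meanSlope k b ψ s (A a) (B a) dA dB ω j) a := by
  have h1 : ∀ x l, HasDerivAt (fun t => affField (A t) s ω x l) (∑ j, dA x l j * ω j) a :=
    fun x l => (HasDerivAt.fun_sum fun j _ => (hA x l j).mul_const (ω j)).sub_const (s l)
  have h2 : ∀ x, HasDerivAt (fun t => linField (B t) ω x) (∑ j, dB x j * ω j) a :=
    fun x => HasDerivAt.fun_sum fun j _ => (hB x j).mul_const (ω j)
  refine (hasDerivAt_softMin hk (M := fun t => energy b ψ (affField (A t) s ω) (linField (B t) ω))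
    fun x => (hasDerivAt_energy (V := fun t => affField (A t) s ω) (w := fun t => linField (B t) ω)
      h1 h2 x).congr_deriv (slope_sum (A a) dA dB ω ω x)).congr_deriv ?_
  simp only [meanSlope, weight, Finset.mul_sum]
  rw [Finset.sum_comm]
  exact Finset.sum_congr rfl fun _ _ => Finset.sum_congr rfl fun _ _ => by ring

lemma hasDerivAt_meanSlope_update [Nonempty κ] [DecidableEq ι] {A dA : κ → J → ι → ℝ}
    {B dB : κ → ι → ℝ} (ω : ι → ℝ) (j : ι) (a : ℝ) :
    HasDerivAt (fun t => meanSlope k b ψ s A B dA dB (Function.update ω j t) j)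
      (meanSlopeDeriv k b ψ s A B dA dB (Function.update ω j a) j) a := by
  set c : ℝ → ι → ℝ := fun t => Function.update ω j t with hc
  set c' : ι → ℝ := Pi.single j 1 with hc'
  have h : ∀ i, HasDerivAt (fun t => c t i) (c' i) a := by
    intro i
    by_cases hi : i = j
    · subst hi
      simpa [hc, hc'] using hasDerivAt_id' a
    · simpa [hc, hc', hi] using hasDerivAt_const a (ω i)
  have sc : ∀ g : ι → ℝ, ∑ i, g i * c' i = g j := by
    intro g
    simp [hc', Pi.single_apply]
  have hp := fun x => hasDerivAt_gibbs (k := k)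
    (M := fun t => energy b ψ (affField A s (c t)) (linField B (c t)))
    (fun x => (hasDerivAt_energy_comp (b := b) (ψ := ψ) (s := s) (A := A) (B := B) h x).congr_deriv
      (sc _)) x
  have hn : ∀ x l, HasDerivAt (fun t => dirField A s (c t) x l)
      (A x l j / smoothNorm (affField A s (c a) x) -
        dirField A s (c a) x l * (∑ i, dirField A s (c a) x i * A x i j) /
          smoothNorm (affField A s (c a) x)) a := fun x l =>
    hasDerivAt_div_smoothNorm (v := fun t => affField A s (c t) x) (v' := fun l => A x l j)
      (fun l => (hasDerivAt_affField_comp h x l).congr_deriv (sc _)) l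
  have hs : ∀ x, HasDerivAt (fun t => slopeField b s A dA dB (c t) x j) _ a := fun x =>
    ((HasDerivAt.fun_sum fun l (_ : l ∈ Finset.univ) => (hn x l).mul_const (dA x l j)).add_const
      (dB x j)).const_mul b
  have := HasDerivAt.fun_sum fun x (_ : x ∈ Finset.univ) => (hp x).mul (hs x)
  exact this

lemma continuous_dirField {A : κ → J → ι → ℝ} (x : κ) (l : J) :
    Continuous fun ω => dirField A s ω x l := continuous_div_field x l

lemma continuous_slopeField {A dA : κ → J → ι → ℝ} {dB : κ → ι → ℝ} (x : κ) (j : ι) :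
    Continuous fun ω => slopeField b s A dA dB ω x j := by
  have := fun l => continuous_dirField (s := s) (A := A) x l
  unfold slopeField
  fun_prop

lemma continuous_weight [Nonempty κ] {A : κ → J → ι → ℝ} {B : κ → ι → ℝ} (x : κ) :
    Continuous fun ω => weight k b ψ s A B ω x :=
  (continuous_gibbs k x).comp continuous_energy_field

lemma continuous_meanSlope [Nonempty κ] {A dA : κ → J → ι → ℝ} {B dB : κ → ι → ℝ} (j : ι) :
    Continuous fun ω => meanSlope k b ψ s A B dA dB ω j := by
  have h1 := fun x => continuous_weight (k := k) (b := b) (ψ := ψ) (s := s) (A := A) (B := B) x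
  have h2 := fun x => continuous_slopeField (b := b) (s := s) (A := A) (dA := dA) (dB := dB) x j
  unfold meanSlope
  fun_prop

lemma continuous_meanSlopeDeriv [Nonempty κ] {A dA : κ → J → ι → ℝ} {B dB : κ → ι → ℝ} (j : ι) :
    Continuous fun ω => meanSlopeDeriv k b ψ s A B dA dB ω j := by
  have h1 := fun x => continuous_weight (k := k) (b := b) (ψ := ψ) (s := s) (A := A) (B := B) x
  have h2 := fun x => continuous_slopeField (b := b) (s := s) (A := A) (dA := dA) (dB := dB) x j
  have h3 := fun x => continuous_slopeField (b := b) (s := s) (A := A) (dA := A) (dB := B) x j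
  have h4 := fun x l => continuous_dirField (s := s) (A := A) x l
  have h5 : ∀ x, Continuous fun ω => (smoothNorm (affField A s ω x))⁻¹ := fun x => by
    refine Continuous.inv₀ ?_ fun ω => (smoothNorm_pos _).ne'
    simp only [affField, smoothNorm]; fun_prop
  unfold meanSlopeDeriv
  simp only [div_eq_mul_inv]
  fun_prop

end Directional

section Bounds

variable {α κ J ι : Type*} [Fintype κ] [Fintype J] [Fintype ι] {k b : ℝ} {ψ : κ → ℝ} {s : J → ℝ}
  {A dA : α → κ → J → ι → ℝ} {B dB : α → κ → ι → ℝ}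

lemma boundedFun_dirField (ω : α → ι → ℝ) (x : κ) (l : J) :
    BoundedFun fun a => dirField (A a) s (ω a) x l := ⟨1, fun _ => abs_div_smoothNorm_le _ _⟩

lemma boundedFun_weight [Nonempty κ] (ω : α → ι → ℝ) (x : κ) :
    BoundedFun fun a => weight k b ψ s (A a) (B a) (ω a) x :=
  ⟨1, fun _ => (abs_of_nonneg (gibbs_nonneg _ _ _)).le.trans (gibbs_le_one _ _ _)⟩

lemma boundedFun_inv_smoothNorm (ω : α → ι → ℝ) (x : κ) :
    BoundedFun fun a => (smoothNorm (affField (A a) s (ω a) x))⁻¹ :=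
  ⟨1, fun _ => by
    rw [abs_of_nonneg (inv_nonneg.2 (smoothNorm_pos _).le)]
    exact inv_le_one_of_one_le₀ (one_le_smoothNorm _)⟩

lemma boundedFun_slopeField (hA' : ∀ x l j, BoundedFun fun a => dA a x l j)
    (hB' : ∀ x j, BoundedFun fun a => dB a x j) (ω : α → ι → ℝ) (x : κ) (j : ι) :
    BoundedFun fun a => slopeField b s (A a) (dA a) (dB a) (ω a) x j :=
  (BoundedFun.const b).mul ((BoundedFun.sum fun l =>
    (boundedFun_dirField ω x l).mul (hA' x l j)).add (hB' x j))

lemma boundedFun_meanSlope [Nonempty κ] (hA' : ∀ x l j, BoundedFun fun a => dA a x l j)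
    (hB' : ∀ x j, BoundedFun fun a => dB a x j) (ω : α → ι → ℝ) (j : ι) :
    BoundedFun fun a => meanSlope k b ψ s (A a) (B a) (dA a) (dB a) (ω a) j :=
  BoundedFun.sum fun x => (boundedFun_weight ω x).mul (boundedFun_slopeField hA' hB' ω x j)

lemma boundedFun_meanSlopeDeriv [Nonempty κ] (hA : ∀ x l j, BoundedFun fun a => A a x l j)
    (hB : ∀ x j, BoundedFun fun a => B a x j) (hA' : ∀ x l j, BoundedFun fun a => dA a x l j)
    (hB' : ∀ x j, BoundedFun fun a => dB a x j) (ω : α → ι → ℝ) (j : ι) :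
    BoundedFun fun a => meanSlopeDeriv k b ψ s (A a) (B a) (dA a) (dB a) (ω a) j := by
  simp only [meanSlopeDeriv, div_eq_mul_inv]
  refine BoundedFun.sum fun x => BoundedFun.add ?_ ?_
  · exact (((BoundedFun.const (-k)).mul (boundedFun_weight ω x)).mul
      ((boundedFun_slopeField hA hB ω x j).sub (BoundedFun.sum fun y => (boundedFun_weight ω y).mul
        (boundedFun_slopeField hA hB ω y j)))).mul (boundedFun_slopeField hA' hB' ω x j)
  · exact (boundedFun_weight ω x).mul ((BoundedFun.const b).mul (BoundedFun.sum fun l =>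
      (((hA x l j).mul (boundedFun_inv_smoothNorm ω x)).sub
        (((boundedFun_dirField ω x l).mul (BoundedFun.sum fun i =>
          (boundedFun_dirField ω x i).mul (hA x i j))).mul
            (boundedFun_inv_smoothNorm ω x))).mul (hA' x l j)))

end Bounds

section Gordon

variable {κ J ι : Type*} [Fintype κ] [Fintype J] [Fintype ι] {k b : ℝ} {ψ : κ → ℝ} {s : J → ℝ}

/-- The Gram identities of a field and its derivative along Gordon's interpolation. -/
structure GordonGram [DecidableEq J] (A dA : κ → J → ι → ℝ) (B dB : κ → ι → ℝ) (q : κ → κ → ℝ) :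
    Prop where
  gram_AA : ∀ y x i l, ∑ j, A y i j * dA x l j = if i = l then -q y x else 0
  gram_AB : ∀ y x i, ∑ j, A y i j * dB x j = 0
  gram_BA : ∀ y x l, ∑ j, B y j * dA x l j = 0
  gram_BB : ∀ y x, ∑ j, B y j * dB x j = q y x
  self : ∀ x, q x x = 0
  nonneg : ∀ y x, 0 ≤ q y x

lemma sum_dirField_mul_le (A : κ → J → ι → ℝ) (ω : ι → ℝ) (x y : κ) :
    ∑ l, dirField A s ω y l * dirField A s ω x l ≤ 1 := by
  have h1 := sum_sq_div_smoothNorm_le (affField A s ω x)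
  have h2 := sum_sq_div_smoothNorm_le (affField A s ω y)
  have : ∑ l, dirField A s ω y l * dirField A s ω x l ≤
      ∑ l, (((affField A s ω y l / smoothNorm (affField A s ω y)) ^ 2 +
        (affField A s ω x l / smoothNorm (affField A s ω x)) ^ 2) / 2) := by
    refine Finset.sum_le_sum fun l _ => ?_
    simp only [dirField]
    nlinarith [sq_nonneg (affField A s ω y l / smoothNorm (affField A s ω y) -
      affField A s ω x l / smoothNorm (affField A s ω x))]
  rw [← Finset.sum_div, Finset.sum_add_distrib] at this
  linarith

lemma slope_gram [DecidableEq J] {A dA : κ → J → ι → ℝ} {B dB : κ → ι → ℝ} {q : κ → κ → ℝ}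
    (h : GordonGram A dA B dB q) (ω : ι → ℝ) (x y : κ) :
    ∑ j, slopeField b s A A B ω y j * slopeField b s A dA dB ω x j =
      b ^ 2 * (q y x * (1 - ∑ l, dirField A s ω y l * dirField A s ω x l)) := by
  have e1 : ∑ j, (∑ i, dirField A s ω y i * A y i j) * (∑ l, dirField A s ω x l * dA x l j) =
      -(q y x) * ∑ l, dirField A s ω y l * dirField A s ω x l := by
    have : ∀ j, (∑ i, dirField A s ω y i * A y i j) * (∑ l, dirField A s ω x l * dA x l j) =
        ∑ i, ∑ l, dirField A s ω y i * dirField A s ω x l * (A y i j * dA x l j) := fun j => by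
      rw [Finset.sum_mul_sum]
      exact Finset.sum_congr rfl fun _ _ => Finset.sum_congr rfl fun _ _ => by ring
    simp_rw [this]
    rw [Finset.sum_comm, Finset.mul_sum]
    refine Finset.sum_congr rfl fun i _ => ?_
    rw [Finset.sum_comm]
    simp_rw [← Finset.mul_sum, h.gram_AA]
    simp only [mul_ite, mul_zero, Finset.sum_ite_eq, Finset.mem_univ, if_true]
    ring
  have e2 : ∑ j, (∑ i, dirField A s ω y i * A y i j) * dB x j = 0 := by
    simp_rw [Finset.sum_mul]
    rw [Finset.sum_comm]
    refine Finset.sum_eq_zero fun i _ => ?_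
    simp_rw [mul_assoc]
    rw [← Finset.mul_sum, h.gram_AB, mul_zero]
  have e3 : ∑ j, B y j * (∑ l, dirField A s ω x l * dA x l j) = 0 := by
    simp_rw [Finset.mul_sum]
    rw [Finset.sum_comm]
    refine Finset.sum_eq_zero fun i _ => ?_
    rw [← mul_zero (dirField A s ω x i), ← h.gram_BA y x i, Finset.mul_sum]
    exact Finset.sum_congr rfl fun _ _ => by ring
  have e : ∀ j, slopeField b s A A B ω y j * slopeField b s A dA dB ω x j =
      b ^ 2 * ((∑ i, dirField A s ω y i * A y i j) * (∑ l, dirField A s ω x l * dA x l j) +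
        (∑ i, dirField A s ω y i * A y i j) * dB x j +
        B y j * (∑ l, dirField A s ω x l * dA x l j) + B y j * dB x j) := fun j => by
    simp only [slopeField]; ring
  simp_rw [e]
  rw [← Finset.mul_sum, Finset.sum_add_distrib, Finset.sum_add_distrib, Finset.sum_add_distrib,
    e1, e2, e3, h.gram_BB]
  ring

lemma sum_meanSlopeDeriv_nonneg [Nonempty κ] [DecidableEq J] (hk : 0 < k) {A dA : κ → J → ι → ℝ}
    {B dB : κ → ι → ℝ} {q : κ → κ → ℝ} (h : GordonGram A dA B dB q) (ω : ι → ℝ) :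
    0 ≤ ∑ j, meanSlopeDeriv k b ψ s A B dA dB ω j := by
  have hz : ∀ x, ∑ j, (b * ∑ l, (A x l j / smoothNorm (affField A s ω x) -
      dirField A s ω x l * (∑ i, dirField A s ω x i * A x i j) /
        smoothNorm (affField A s ω x)) * dA x l j) = 0 := by
    intro x
    rw [← Finset.mul_sum, Finset.sum_comm]
    refine mul_eq_zero_of_right _ (Finset.sum_eq_zero fun l _ => ?_)
    have : ∀ j, (A x l j / smoothNorm (affField A s ω x) -
      dirField A s ω x l * (∑ i, dirField A s ω x i * A x i j) /
        smoothNorm (affField A s ω x)) * dA x l j = (smoothNorm (affField A s ω x))⁻¹ *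
        (A x l j * dA x l j) - dirField A s ω x l * (smoothNorm (affField A s ω x))⁻¹ *
          ∑ i, dirField A s ω x i * (A x i j * dA x l j) := by
      intro j
      have e : ∑ i, dirField A s ω x i * (A x i j * dA x l j) =
          (∑ i, dirField A s ω x i * A x i j) * dA x l j := by
        rw [Finset.sum_mul]
        exact Finset.sum_congr rfl fun _ _ => by ring
      rw [e]
      ring
    simp_rw [this]
    rw [Finset.sum_sub_distrib, ← Finset.mul_sum, ← Finset.mul_sum, Finset.sum_comm]
    simp_rw [← Finset.mul_sum, h.gram_AA, h.self]
    simp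
  have e : ∑ j, meanSlopeDeriv k b ψ s A B dA dB ω j =
      ∑ x, ∑ y, k * weight k b ψ s A B ω x * weight k b ψ s A B ω y *
        (b ^ 2 * (q y x * (1 - ∑ l, dirField A s ω y l * dirField A s ω x l))) := by
    simp only [meanSlopeDeriv]
    rw [Finset.sum_comm]
    refine Finset.sum_congr rfl fun x _ => ?_
    rw [Finset.sum_add_distrib, ← Finset.mul_sum, hz x, mul_zero, add_zero]
    have : ∀ j, -k * weight k b ψ s A B ω x * (slopeField b s A A B ω x j -
      ∑ y, weight k b ψ s A B ω y * slopeField b s A A B ω y j) * slopeField b s A dA dB ω x j =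
      -k * weight k b ψ s A B ω x * (slopeField b s A A B ω x j * slopeField b s A dA dB ω x j) +
        ∑ y, k * weight k b ψ s A B ω x * weight k b ψ s A B ω y *
          (slopeField b s A A B ω y j * slopeField b s A dA dB ω x j) := by
      intro j
      have e : ∑ y, k * weight k b ψ s A B ω x * weight k b ψ s A B ω y *
          (slopeField b s A A B ω y j * slopeField b s A dA dB ω x j) =
          (k * weight k b ψ s A B ω x * slopeField b s A dA dB ω x j) *
            ∑ y, weight k b ψ s A B ω y * slopeField b s A A B ω y j := by
        rw [Finset.mul_sum]
        exact Finset.sum_congr rfl fun _ _ => by ring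
      rw [e]
      ring
    simp_rw [this]
    rw [Finset.sum_add_distrib, ← Finset.mul_sum, slope_gram h, h.self, Finset.sum_comm]
    simp_rw [← Finset.mul_sum, slope_gram h]
    ring
  rw [e]
  refine Finset.sum_nonneg fun x _ => Finset.sum_nonneg fun y _ => ?_
  have h1 : 0 ≤ weight k b ψ s A B ω x := gibbs_nonneg _ _ _
  have h2 : 0 ≤ weight k b ψ s A B ω y := gibbs_nonneg _ _ _
  have h3 := h.nonneg y x
  have h4 := sub_nonneg.2 (sum_dirField_mul_le (s := s) A ω x y)
  positivity

/-- Gaussian integration by parts for the derivative of the smooth min-max functional. -/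
lemma integral_sum_coord_meanSlope [Nonempty κ] (A dA : κ → J → ι → ℝ) (B dB : κ → ι → ℝ) :
    ∫ ω, ∑ j, ω j * meanSlope k b ψ s A B dA dB ω j ∂(stdPi ι) =
      ∫ ω, ∑ j, meanSlopeDeriv k b ψ s A B dA dB ω j ∂(stdPi ι) := by
  classical
  have hb : ∀ j, BoundedFun fun ω => meanSlope k b ψ s A B dA dB ω j := fun j =>
    boundedFun_meanSlope (A := fun _ => A) (B := fun _ => B) (dA := fun _ => dA) (dB := fun _ => dB)
      (fun _ _ _ => .const _) (fun _ _ => .const _) (fun ω => ω) j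
  have hb' : ∀ j, BoundedFun fun ω => meanSlopeDeriv k b ψ s A B dA dB ω j := fun j =>
    boundedFun_meanSlopeDeriv (A := fun _ => A) (B := fun _ => B) (dA := fun _ => dA)
      (dB := fun _ => dB) (fun _ _ _ => .const _) (fun _ _ => .const _) (fun _ _ _ => .const _)
      (fun _ _ => .const _) (fun ω => ω) j
  have hi : ∀ j, Integrable (fun ω => meanSlopeDeriv k b ψ s A B dA dB ω j) (stdPi ι) := by
    intro j
    obtain ⟨C, hC⟩ := hb' j
    exact Integrable.of_bound (continuous_meanSlopeDeriv j).aestronglyMeasurable C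
      (ae_of_all _ hC)
  have hi2 : ∀ j, Integrable (fun ω => ω j * meanSlope k b ψ s A B dA dB ω j) (stdPi ι) := by
    intro j
    obtain ⟨C, hC⟩ := hb j
    have h1 : Integrable (fun ω : ι → ℝ => ω j) (stdPi ι) :=
      (stdPi_measurePreserving_eval j).integrable_comp_of_integrable
        (gaussianReal_integrable_of_le (f := fun t => t) (by fun_prop) 1 fun t => by
          rw [abs_le]; constructor <;> nlinarith [sq_nonneg (t - 1), sq_nonneg (t + 1)])
    exact h1.mul_bdd (c := C) (continuous_meanSlope j).aestronglyMeasurable (ae_of_all _ hC)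
  rw [integral_finsetSum _ fun j _ => hi2 j, integral_finsetSum _ fun j _ => hi j]
  refine Finset.sum_congr rfl fun j _ => ?_
  obtain ⟨C, hC⟩ := hb j
  obtain ⟨C', hC'⟩ := hb' j
  exact stdPi_integral_coord_mul (C := max C C') j (continuous_meanSlope j)
    (continuous_meanSlopeDeriv j) (fun ω t => hasDerivAt_meanSlope_update ω j t)
    (fun ω => (hC ω).trans (le_max_left _ _)) (fun ω => (hC' ω).trans (le_max_right _ _))

lemma smoothNorm_le_sum (v : J → ℝ) : smoothNorm v ≤ ∑ l, |v l| + 1 := by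
  refine (smoothNorm_le v).trans (add_le_add_left ?_ 1)
  refine Real.sqrt_le_iff.2 ⟨by positivity, ?_⟩
  have := Finset.sum_sq_le_sq_sum_of_nonneg (s := Finset.univ) (f := fun l => |v l|)
    fun _ _ => abs_nonneg _
  simpa using this

lemma abs_softMin_le [Nonempty κ] (hk : 0 < k) (M : κ → ℝ) :
    |softMin k M| ≤ ∑ x, |M x| + log (Fintype.card κ) / k := by
  have hl : 0 ≤ log (Fintype.card κ) / k :=
    div_nonneg (log_nonneg (by exact_mod_cast Fintype.card_pos)) hk.le
  have hM : ∀ x, |M x| ≤ ∑ y, |M y| := fun x =>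
    Finset.single_le_sum (f := fun y => |M y|) (fun _ _ => abs_nonneg _) (Finset.mem_univ x)
  rw [abs_le]
  constructor
  · have := le_softMin hk (M := M) (c := -∑ y, |M y|) fun x =>
      (neg_le_neg (hM x)).trans (neg_abs_le _)
    linarith
  · obtain ⟨x⟩ := ‹Nonempty κ›
    have := (softMin_le hk M x).trans ((le_abs_self _).trans (hM x))
    linarith

lemma integrable_coord (j : ι) : Integrable (fun ω : ι → ℝ => ω j) (stdPi ι) :=
  (stdPi_measurePreserving_eval j).integrable_comp_of_integrable
    (gaussianReal_integrable_of_le (f := fun t => t) (by fun_prop) 1 fun t => by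
      rw [abs_le]; constructor <;> nlinarith [sq_nonneg (t - 1), sq_nonneg (t + 1)])

lemma integrable_minMax [Nonempty κ] (hk : 0 < k) (A : κ → J → ι → ℝ) (B : κ → ι → ℝ) :
    Integrable (minMax k b ψ s A B) (stdPi ι) := by
  have hA : ∀ x l, Integrable (fun ω : ι → ℝ => affField A s ω x l) (stdPi ι) := fun x l =>
    (integrable_finsetSum _ fun j _ => (integrable_coord j).const_mul (A x l j)).sub
      (integrable_const _)
  have hB : ∀ x, Integrable (fun ω : ι → ℝ => linField B ω x) (stdPi ι) := fun x =>
    integrable_finsetSum _ fun j _ => (integrable_coord j).const_mul (B x j)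
  have hE : ∀ x, Integrable (fun ω : ι → ℝ =>
      energy b ψ (affField A s ω) (linField B ω) x) (stdPi ι) := by
    intro x
    have hN : Integrable (fun ω : ι → ℝ => smoothNorm (affField A s ω x)) (stdPi ι) := by
      refine Integrable.mono' (g := fun ω => ∑ l, |affField A s ω x l| + 1)
        ((integrable_finsetSum _ fun l _ => (hA x l).abs).add (integrable_const 1)) ?_ ?_
      · have h : Continuous fun ω : ι → ℝ => affField A s ω x := by
          unfold affField; fun_prop
        exact (continuous_smoothNorm.comp h).aestronglyMeasurable
      · refine ae_of_all _ fun ω => ?_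
        rw [norm_eq_abs, abs_of_pos (smoothNorm_pos _)]
        exact smoothNorm_le_sum _
    exact ((hN.add (hB x)).const_mul b).add (integrable_const _)
  refine Integrable.mono' (g := fun ω =>
    ∑ x, |energy b ψ (affField A s ω) (linField B ω) x| + log (Fintype.card κ) / k)
    ((integrable_finsetSum _ fun x _ => (hE x).abs).add (integrable_const _))
    continuous_minMax.aestronglyMeasurable (ae_of_all _ fun ω => abs_softMin_le hk _)

/-- Gordon's comparison inequality for the smooth min-max functional. -/
theorem gordon_minMax [Nonempty κ] [DecidableEq J] (hk : 0 < k) {P Q : κ → J → ι → ℝ}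
    {PB QB : κ → ι → ℝ} {q : κ → κ → ℝ}
    (hAA : ∀ y x i l, ∑ j, P y i j * P x l j - ∑ j, Q y i j * Q x l j =
      if i = l then -q y x else 0)
    (hAB : ∀ y x i, ∑ j, P y i j * PB x j - ∑ j, Q y i j * QB x j = 0)
    (hBB : ∀ y x, ∑ j, PB y j * PB x j - ∑ j, QB y j * QB x j = q y x)
    (hself : ∀ x, q x x = 0) (hq : ∀ y x, 0 ≤ q y x)
    (dAA : ∀ y x i l j, P y i j * Q x l j = 0) (dAB : ∀ y x i j, P y i j * QB x j = 0)
    (dBA : ∀ y x i j, Q y i j * PB x j = 0) (dBB : ∀ y x j, PB y j * QB x j = 0) :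
    ∫ ω, minMax k b ψ s Q QB ω ∂(stdPi ι) ≤ ∫ ω, minMax k b ψ s P PB ω ∂(stdPi ι) := by
  set A : ℝ → κ → J → ι → ℝ := fun a x l j => sin a * P x l j + cos a * Q x l j with hA
  set dA : ℝ → κ → J → ι → ℝ := fun a x l j => cos a * P x l j - sin a * Q x l j with hA'
  set B : ℝ → κ → ι → ℝ := fun a x j => sin a * PB x j + cos a * QB x j with hB
  set dB : ℝ → κ → ι → ℝ := fun a x j => cos a * PB x j - sin a * QB x j with hB'
  have gram : ∀ (a : ℝ) (f f' g g' : ι → ℝ), (∀ j, f j * g' j = 0) → (∀ j, f' j * g j = 0) →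
      ∑ j, (sin a * f j + cos a * f' j) * (cos a * g j - sin a * g' j) =
        sin a * cos a * (∑ j, f j * g j - ∑ j, f' j * g' j) := by
    intro a f f' g g' h1 h2
    rw [← Finset.sum_sub_distrib, Finset.mul_sum]
    refine Finset.sum_congr rfl fun j _ => ?_
    linear_combination (-(sin a) ^ 2) * h1 j + (cos a) ^ 2 * h2 j
  have hG : ∀ a, 0 ≤ sin a * cos a →
      GordonGram (A a) (dA a) (B a) (dB a) (fun y x => sin a * cos a * q y x) := by
    intro a ha
    refine ⟨fun y x i l => ?_, fun y x i => ?_, fun y x l => ?_, fun y x => ?_,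
      fun x => by simp [hself], fun y x => mul_nonneg ha (hq y x)⟩
    · refine (gram a _ _ _ _ (dAA y x i l) fun j => by rw [mul_comm]; exact dAA x y l i j).trans ?_
      rw [hAA]
      split_ifs <;> ring
    · refine (gram a _ _ _ _ (dAB y x i) (dBA y x i)).trans ?_
      rw [hAB, mul_zero]
    · refine (gram a _ _ _ _ (fun j => by rw [mul_comm]; exact dBA x y l j)
        fun j => by rw [mul_comm]; exact dAB x y l j).trans ?_
      have := hAB x y l
      simp_rw [mul_comm] at this ⊢
      rw [this]
      ring
    · refine (gram a _ _ _ _ (dBB y x) fun j => by rw [mul_comm]; exact dBB x y j).trans ?_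
      rw [hBB]
  have hAd : ∀ a x l j, HasDerivAt (fun t => A t x l j) (dA a x l j) a := fun a x l j =>
    (((hasDerivAt_sin a).mul_const _).add ((hasDerivAt_cos a).mul_const _)).congr_deriv
      (by simp only [hA']; ring)
  have hBd : ∀ a x j, HasDerivAt (fun t => B t x j) (dB a x j) a := fun a x j =>
    (((hasDerivAt_sin a).mul_const _).add ((hasDerivAt_cos a).mul_const _)).congr_deriv
      (by simp only [hB']; ring)
  have bs : BoundedFun (fun a : ℝ × (ι → ℝ) => sin a.1) := ⟨1, fun a => abs_sin_le_one _⟩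
  have bc : BoundedFun (fun a : ℝ × (ι → ℝ) => cos a.1) := ⟨1, fun a => abs_cos_le_one _⟩
  have hbd : ∀ j : ι, BoundedFun fun a : ℝ × (ι → ℝ) =>
      meanSlope k b ψ s (A a.1) (B a.1) (dA a.1) (dB a.1) a.2 j := fun j =>
    boundedFun_meanSlope (A := fun a : ℝ × (ι → ℝ) => A a.1) (B := fun a : ℝ × (ι → ℝ) => B a.1)
      (dA := fun a : ℝ × (ι → ℝ) => dA a.1) (dB := fun a : ℝ × (ι → ℝ) => dB a.1)
      (fun x l j => (bc.mul (.const _)).sub (bs.mul (.const _)))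
      (fun x j => (bc.mul (.const _)).sub (bs.mul (.const _))) (fun a => a.2) j
  choose C hC using hbd
  have hderiv : ∀ a, HasDerivAt (fun t => ∫ ω, minMax k b ψ s (A t) (B t) ω ∂(stdPi ι))
      (∫ ω, ∑ j, ω j * meanSlope k b ψ s (A a) (B a) (dA a) (dB a) ω j ∂(stdPi ι)) a := by
    intro a
    refine (hasDerivAt_integral_of_dominated_loc_of_deriv_le (s := Set.univ) Filter.univ_mem
      (F := fun t ω => minMax k b ψ s (A t) (B t) ω)
      (F' := fun t ω => ∑ j, ω j * meanSlope k b ψ s (A t) (B t) (dA t) (dB t) ω j)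
      (bound := fun ω => ∑ j, |ω j| * C j)
      (Filter.Eventually.of_forall fun t => continuous_minMax.aestronglyMeasurable)
      (integrable_minMax hk _ _) ?_ ?_ ?_ ?_).2
    · refine Continuous.aestronglyMeasurable (continuous_finsetSum _ fun j _ => ?_)
      exact (continuous_apply j).mul (continuous_meanSlope j)
    · refine ae_of_all _ fun ω t _ => (Finset.abs_sum_le_sum_abs _ _).trans
        (Finset.sum_le_sum fun j _ => ?_)
      rw [abs_mul]
      exact mul_le_mul_of_nonneg_left (hC j (t, ω)) (abs_nonneg _)
    · exact integrable_finsetSum _ fun j _ => (integrable_coord j).abs.mul_const _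
    · exact ae_of_all _ fun ω t _ => hasDerivAt_minMax_param hk (hAd t) (hBd t) ω
  have hmono : MonotoneOn (fun t => ∫ ω, minMax k b ψ s (A t) (B t) ω ∂(stdPi ι))
      (Set.Icc 0 (π / 2)) := by
    refine monotoneOn_of_deriv_nonneg (convex_Icc _ _)
      (fun a _ => (hderiv a).continuousAt.continuousWithinAt)
      (fun a _ => (hderiv a).differentiableAt.differentiableWithinAt) fun a ha => ?_
    rw [interior_Icc] at ha
    rw [(hderiv a).deriv, integral_sum_coord_meanSlope]
    refine integral_nonneg fun ω => sum_meanSlopeDeriv_nonneg hk (hG a (mul_nonneg ?_ ?_)) ω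
    · exact (sin_pos_of_pos_of_lt_pi ha.1 (by linarith [ha.2, pi_pos])).le
    · exact (cos_pos_of_mem_Ioo ⟨by linarith [ha.1, pi_pos], ha.2⟩).le
  have := hmono (Set.left_mem_Icc.2 (by positivity)) (Set.right_mem_Icc.2 (by positivity))
    (by positivity : (0 : ℝ) ≤ π / 2)
  simpa [hA, hB] using this

end Gordon

section PrimaryOptimization

variable {κ J I : Type*} [Fintype κ] [Fintype J] [Fintype I] [DecidableEq J] [DecidableEq I]
  {k b : ℝ} {ψ : κ → ℝ} {s : J → ℝ}

/-- The field `x ↦ W y_x` of a Gaussian matrix `W`. -/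
def matField (y : κ → I → ℝ) (x : κ) (l : J) (j : J × I) : ℝ := if j.1 = l then y x j.2 else 0

lemma sum_matField (y : κ → I → ℝ) (x : κ) (l : J) (f : J × I → ℝ) :
    ∑ j, matField y x l j * f j = ∑ i, y x i * f (l, i) := by
  rw [Fintype.sum_prod_type]
  simp [matField]

lemma softMin_le_softMin_add [Nonempty κ] (hk : 0 < k) {M M' : κ → ℝ} {c : ℝ}
    (h : ∀ x, M x ≤ M' x + c) : softMin k M ≤ softMin k M' + c := by
  have h1 : exp (-k * c) * ∑ x, exp (-k * M' x) ≤ ∑ x, exp (-k * M x) := by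
    rw [Finset.mul_sum]
    refine Finset.sum_le_sum fun x _ => ?_
    rw [← exp_add]
    exact exp_le_exp.2 (by nlinarith [h x])
  have h2 := log_le_log (mul_pos (exp_pos _) (sum_exp_pos k M')) h1
  rw [log_mul (exp_pos _).ne' (sum_exp_pos k M').ne', log_exp] at h2
  unfold softMin
  rw [← sub_nonneg]
  have : -log (∑ x, exp (-k * M' x)) / k + c - -log (∑ x, exp (-k * M x)) / k =
      (log (∑ x, exp (-k * M x)) - (-k * c + log (∑ x, exp (-k * M' x)))) / k := by
    field_simp; ring
  rw [this]
  exact div_nonneg (by linarith) hk.le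

/-- Gordon's lower bound on the mean of the smoothed primary optimization. -/
theorem integral_minMax_matField_ge [Nonempty κ] (hk : 0 < k) (hb : 0 ≤ b) {y : κ → I → ℝ} {R : ℝ}
    (hR : ∀ x, √(∑ i, y x i ^ 2) ≤ R) {G : (J ⊕ I → ℝ) → ℝ} (hG : Integrable G (stdPi (J ⊕ I)))
    (hle : ∀ x ω, G ω ≤ b * (√(∑ l, (√(∑ i, y x i ^ 2) * ω (Sum.inl l) - s l) ^ 2) -
      ∑ i, y x i * ω (Sum.inr i)) + ψ x) :
    ∫ ω, G ω ∂(stdPi (J ⊕ I)) - log (Fintype.card κ) / k - b * R ≤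
      ∫ ω, minMax k b ψ s (matField y) 0 ω ∂(stdPi (J × I)) := by
  set r : κ → ℝ := fun x => √(∑ i, y x i ^ 2) with hr
  have hr0 : ∀ x, 0 ≤ r x := fun x => sqrt_nonneg _
  have hr2 : ∀ x, r x * r x = ∑ i, y x i * y x i := fun x => by
    rw [← sq, sq_sqrt (by positivity)]
    simp_rw [sq]
  let ι := (J × I) ⊕ (Unit ⊕ (J ⊕ I))
  let P : κ → J → ι → ℝ := fun x l => Sum.elim (matField y x l) fun _ => 0
  let PB : κ → ι → ℝ := fun x => Sum.elim (fun _ => 0) (Sum.elim (fun _ => r x) fun _ => 0)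
  let Q : κ → J → ι → ℝ := fun x l => Sum.elim (fun _ => 0) (Sum.elim (fun _ => 0)
    (Sum.elim (fun l' => if l' = l then r x else 0) fun _ => 0))
  let QB : κ → ι → ℝ := fun x => Sum.elim (fun _ => 0) (Sum.elim (fun _ => 0)
    (Sum.elim (fun _ => 0) fun i => -y x i))
  have hcomp := gordon_minMax (k := k) (b := b) (ψ := ψ) (s := s) hk (P := P) (Q := Q) (PB := PB)
    (QB := QB) (q := fun u v => r u * r v - ∑ i, y u i * y v i) ?_ ?_ ?_ ?_ ?_ ?_ ?_ ?_ ?_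
  · let e : J ⊕ I → ι := fun j => Sum.inr (Sum.inr j)
    have he : Function.Injective e := fun _ _ h => Sum.inr_injective (Sum.inr_injective h)
    let w : J × I → ι := Sum.inl
    have hw : Function.Injective w := Sum.inl_injective
    have h0 := stdPi_measurePreserving_eval (ι := ι) (Sum.inr (Sum.inl ()))
    have low : ∫ ω, G ω ∂(stdPi (J ⊕ I)) - log (Fintype.card κ) / k ≤
        ∫ ω, minMax k b ψ s Q QB ω ∂(stdPi ι) := by
      have hmp := stdPi_measurePreserving_comp he
      have hGi : Integrable (fun ω : ι → ℝ => G fun j => ω (e j)) (stdPi ι) :=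
        hmp.integrable_comp_of_integrable hG
      have hint : ∫ ω, G ω ∂(stdPi (J ⊕ I)) = ∫ ω, G (fun j => ω (e j)) ∂(stdPi ι) := by
        rw [← hmp.map_eq, integral_map hmp.measurable.aemeasurable]
        rw [hmp.map_eq]
        exact hG.aestronglyMeasurable
      rw [hint, show ∫ ω, G (fun j => ω (e j)) ∂(stdPi ι) - log (Fintype.card κ) / k =
        ∫ ω, (G (fun j => ω (e j)) - log (Fintype.card κ) / k) ∂(stdPi ι) by
          rw [integral_sub hGi (integrable_const _)]; simp]
      refine integral_mono (hGi.sub (integrable_const _)) (integrable_minMax hk _ _) fun ω => ?_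
      refine le_softMin hk fun x => (hle x fun j => ω (e j)).trans ?_
      have e1 : affField Q s ω x = fun l => r x * ω (e (Sum.inl l)) - s l := by
        funext l
        simp [affField, Q, e, ι]
      have e2 : linField QB ω x = -∑ i, y x i * ω (e (Sum.inr i)) := by
        simp [linField, QB, e, ι]
      simp only [energy]
      rw [e1, e2]
      have := sqrt_le_smoothNorm fun l => r x * ω (e (Sum.inl l)) - s l
      have := mul_le_mul_of_nonneg_left this hb
      simp only [hr] at this ⊢
      linarith
    have up : ∫ ω, minMax k b ψ s P PB ω ∂(stdPi ι) ≤
        ∫ ω, minMax k b ψ s (matField y) 0 ω ∂(stdPi (J × I)) + b * R := by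
      have hmp := stdPi_measurePreserving_comp hw
      have hi : Integrable (fun ω : ι → ℝ => minMax k b ψ s (matField y) 0 fun j => ω (w j))
          (stdPi ι) := hmp.integrable_comp_of_integrable (integrable_minMax hk _ _)
      have hint : ∫ ω, minMax k b ψ s (matField y) 0 ω ∂(stdPi (J × I)) =
          ∫ ω, minMax k b ψ s (matField y) 0 (fun j => ω (w j)) ∂(stdPi ι) := by
        rw [← hmp.map_eq, integral_map hmp.measurable.aemeasurable]
        exact continuous_minMax.aestronglyMeasurable
      have hg : Integrable (fun ω : ι → ℝ => b * R * ((ω (Sum.inr (Sum.inl ())) ^ 2 + 1) / 2))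
          (stdPi ι) := by
        have : Integrable (fun t : ℝ => b * R * ((t ^ 2 + 1) / 2)) (gaussianReal 0 1) :=
          ((gaussianReal_integrable_of_le (f := fun t => (t ^ 2 + 1) / 2) (by fun_prop) 1
            fun t => by rw [abs_of_nonneg (by positivity)]; nlinarith [sq_nonneg t])).const_mul _
        exact h0.integrable_comp_of_integrable this
      have hgi : ∫ ω : ι → ℝ, b * R * ((ω (Sum.inr (Sum.inl ())) ^ 2 + 1) / 2) ∂(stdPi ι) =
          b * R := by
        have e1 : ∫ t, b * R * ((t ^ 2 + 1) / 2) ∂(gaussianReal 0 1) = b * R := by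
          rw [integral_const_mul, integral_div, integral_add _ (integrable_const _),
            gaussianReal_integral_sq]
          · simp
          · exact gaussianReal_integrable_of_le (by fun_prop) 1
              fun t => by rw [abs_of_nonneg (by positivity)]; nlinarith [sq_nonneg t]
        have hc : Continuous fun t : ℝ => b * R * ((t ^ 2 + 1) / 2) := by fun_prop
        have e2 := integral_map (μ := stdPi ι) h0.measurable.aemeasurable
          (f := fun t : ℝ => b * R * ((t ^ 2 + 1) / 2)) hc.aestronglyMeasurable
        rw [← e2, h0.map_eq, e1]
      rw [hint]
      refine le_of_le_of_eq ?_ (congrArg _ hgi)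
      rw [← integral_add hi hg]
      refine integral_mono (integrable_minMax hk _ _) (hi.add hg) fun ω => ?_
      refine softMin_le_softMin_add hk fun x => ?_
      have e1 : affField P s ω x = affField (matField y) s (fun j => ω (w j)) x := by
        funext l
        simp [affField, P, w, ι]
      have e2 : linField PB ω x = r x * ω (Sum.inr (Sum.inl ())) := by
        simp [linField, PB, ι]
      have e3 : linField (0 : κ → J × I → ℝ) (fun j => ω (w j)) x = 0 := by simp [linField]
      simp only [energy]
      rw [e1, e2, e3]
      have h1 : r x * ω (Sum.inr (Sum.inl ())) ≤ R * ((ω (Sum.inr (Sum.inl ())) ^ 2 + 1) / 2) := by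
        have := hR x
        have := hr0 x
        have h3 : ω (Sum.inr (Sum.inl ())) ≤ (ω (Sum.inr (Sum.inl ())) ^ 2 + 1) / 2 := by
          nlinarith [sq_nonneg (ω (Sum.inr (Sum.inl ())) - 1)]
        exact (mul_le_mul_of_nonneg_left h3 (hr0 x)).trans
          (mul_le_mul_of_nonneg_right (hR x) (by positivity))
      have := mul_le_mul_of_nonneg_left h1 hb
      linarith
    linarith
  · intro u v i l
    have e1 : ∑ j, P u i j * P v l j = if i = l then ∑ i, y u i * y v i else 0 := by
      have := sum_matField y u i fun j => matField y v l j
      simp only [P, ι, Fintype.sum_sum_type, Sum.elim_inl, Sum.elim_inr, mul_zero,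
        Finset.sum_const_zero, add_zero, this]
      split_ifs with h <;> simp [matField, h]
    have e2 : ∑ j, Q u i j * Q v l j = if i = l then r u * r v else 0 := by
      split_ifs with h
      · subst h; simp [Q, ι]
      · simp [Q, ι, Ne.symm h]
    rw [e1, e2]
    split_ifs <;> ring
  · intro u v i
    simp [P, PB, Q, QB, ι]
  · intro u v
    simp [PB, QB, ι]
  · intro x
    simp only [hr2, sub_self]
  · intro u v
    have := Real.sum_mul_le_sqrt_mul_sqrt Finset.univ (y u) (y v)
    simp only [hr]
    linarith
  · rintro u v i l (j | j | j | j) <;> simp [P, Q]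
  · rintro u v i (j | j | j | j) <;> simp [P, QB]
  · rintro u v i (j | j | j | j) <;> simp [Q, PB]
  · rintro u v (j | j | j | j) <;> simp [PB, QB]

/-- Gaussian concentration of the smoothed primary optimization. -/
theorem minMax_matField_lower_tail [Nonempty κ] (hk : 0 < k) {y : κ → I → ℝ} {R : ℝ}
    (hR : ∀ x, ∑ i, y x i ^ 2 ≤ R) (hb : 0 < b) (hR0 : 0 < R) {t : ℝ} (ht : 0 ≤ t) :
    stdPi (J × I) {ω | minMax k b ψ s (matField y) 0 ω ≤
      ∫ η, minMax k b ψ s (matField y) 0 η ∂(stdPi (J × I)) - t} ≤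
      ENNReal.ofReal (exp (-(2 * t ^ 2 / (π ^ 2 * (b ^ 2 * R))))) := by
  refine stdPi_lower_tail (F := minMax k b ψ s (matField y) 0)
    (D := meanSlope k b ψ s (matField y) 0 (matField y) 0)
    (hasDerivAt_minMax_comp hk) continuous_minMax (integrable_minMax hk _ _)
    (continuous_pi fun j => continuous_meanSlope j) (fun ω => ?_) (by positivity) ht
  have hx : ∀ x, ∑ j, slopeField b s (matField y) (matField y) 0 ω x j ^ 2 ≤ b ^ 2 * R := by
    intro x
    have e : ∀ j : J × I, slopeField b s (matField y) (matField y) 0 ω x j =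
        b * (dirField (matField y) s ω x j.1 * y x j.2) := by
      rintro ⟨l, i⟩
      simp [slopeField, matField]
    simp_rw [e, mul_pow]
    rw [← Finset.mul_sum, Fintype.sum_prod_type]
    simp only
    rw [← Finset.sum_mul_sum]
    have h1 := sum_sq_div_smoothNorm_le (affField (matField y) s ω x)
    have h2 : 0 ≤ ∑ i, y x i ^ 2 := by positivity
    have h3 : (∑ l, dirField (matField y) s ω x l ^ 2) * ∑ i, y x i ^ 2 ≤ 1 * R :=
      mul_le_mul h1 (hR x) h2 zero_le_one
    rw [one_mul] at h3
    exact mul_le_mul_of_nonneg_left h3 (by positivity)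
  have hw := sum_gibbs k (energy b ψ (affField (matField y) s ω) (linField 0 ω))
  have hj : ∀ j, meanSlope k b ψ s (matField y) 0 (matField y) 0 ω j ^ 2 ≤
      ∑ x, weight k b ψ s (matField y) 0 ω x *
        slopeField b s (matField y) (matField y) 0 ω x j ^ 2 := fun j => by
    have := ((even_two (α := ℕ)).convexOn_pow (𝕜 := ℝ)).map_sum_le (t := Finset.univ)
      (w := fun x => weight k b ψ s (matField y) 0 ω x)
      (p := fun x => slopeField b s (matField y) (matField y) 0 ω x j)
      (fun x _ => gibbs_nonneg _ _ _) hw fun x _ => Set.mem_univ _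
    simpa [meanSlope] using this
  calc ∑ j, meanSlope k b ψ s (matField y) 0 (matField y) 0 ω j ^ 2
      ≤ ∑ j, ∑ x, weight k b ψ s (matField y) 0 ω x *
        slopeField b s (matField y) (matField y) 0 ω x j ^ 2 := Finset.sum_le_sum fun j _ => hj j
    _ = ∑ x, weight k b ψ s (matField y) 0 ω x *
        ∑ j, slopeField b s (matField y) (matField y) 0 ω x j ^ 2 := by
      rw [Finset.sum_comm]
      simp_rw [Finset.mul_sum]
    _ ≤ ∑ x, weight k b ψ s (matField y) 0 ω x * (b ^ 2 * R) :=
      Finset.sum_le_sum fun x _ => mul_le_mul_of_nonneg_left (hx x) (gibbs_nonneg _ _ _)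
    _ = b ^ 2 * R := by
      rw [← Finset.sum_mul]
      simp only [weight]
      rw [hw, one_mul]

end PrimaryOptimization

section Scalar

variable {δ lam A τ β : ℝ}

lemma abs_Xstar_le (hA : 0 < A) (h : ℝ) : |Xstar lam A τ β h| ≤ A := by
  unfold Xstar
  rw [abs_le]
  exact ⟨le_max_left _ _, max_le (by linarith) (min_le_left _ _)⟩

lemma continuous_Xstar : Continuous (Xstar lam A τ β) := by
  unfold Xstar
  fun_prop

lemma Xstar_optimality (hA : 0 < A) (hα : 0 < 1 / τ + 2 * lam / β) (h : ℝ) {x : ℝ} (hx : |x| ≤ A) :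
    0 ≤ ((1 / τ + 2 * lam / β) * Xstar lam A τ β h - h) * (x - Xstar lam A τ β h) := by
  unfold Xstar
  set α := 1 / τ + 2 * lam / β
  rw [abs_le] at hx
  have e : α * (h / α) = h := mul_div_cancel₀ _ hα.ne'
  rcases le_total A (h / α) with h1 | h1
  · rw [min_eq_left h1, max_eq_right (by linarith)]
    have := mul_le_mul_of_nonneg_left h1 hα.le
    exact mul_nonneg_of_nonpos_of_nonpos (by linarith) (by linarith)
  · rw [min_eq_right h1]
    rcases le_total (h / α) (-A) with h2 | h2
    · rw [max_eq_left h2]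
      have := mul_le_mul_of_nonneg_left h2 hα.le
      exact mul_nonneg (by linarith) (by linarith)
    · rw [max_eq_right h2, e]
      simp

lemma Xstar_eq_div {h : ℝ} (hA : 0 < A)
    (h1 : |Xstar lam A τ β h| < A) : Xstar lam A τ β h = h / (1 / τ + 2 * lam / β) := by
  unfold Xstar at *
  rw [abs_lt] at h1
  set α := 1 / τ + 2 * lam / β
  rcases le_total A (h / α) with h2 | h2
  · rw [min_eq_left h2, max_eq_right (by linarith)] at h1
    linarith [h1.2]
  · rw [min_eq_right h2] at h1 ⊢
    rcases le_total (h / α) (-A) with h3 | h3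
    · rw [max_eq_left h3] at h1
      linarith [h1.1]
    · exact max_eq_right h3

lemma abs_Xstar_le_div (hα : 0 < 1 / τ + 2 * lam / β) (hA : 0 < A) (h : ℝ) :
    |Xstar lam A τ β h| ≤ |h| / (1 / τ + 2 * lam / β) := by
  rw [show |h| / (1 / τ + 2 * lam / β) = |h / (1 / τ + 2 * lam / β)| by
    rw [abs_div, abs_of_pos hα]]
  unfold Xstar
  set α := 1 / τ + 2 * lam / β
  have := le_abs_self (h / α)
  have := neg_abs_le (h / α)
  have := abs_nonneg (h / α)
  rw [abs_le]
  constructor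
  · exact (le_min (by linarith) (by linarith)).trans (le_max_right _ _)
  · exact max_le (by linarith) ((min_le_right _ _).trans (by linarith))

lemma sInf_scalar (hA : 0 < A) (hβ : 0 < β) (hα : 0 < 1 / τ + 2 * lam / β) (h : ℝ) :
    sInf ((fun x : ℝ => β / (2 * τ) * x ^ 2 + lam * x ^ 2 - β * h * x) '' Set.Icc (-A) A) =
      (β / (2 * τ) + lam) * Xstar lam A τ β h ^ 2 - β * (h * Xstar lam A τ β h) := by
  have hX := abs_le.1 (abs_Xstar_le (lam := lam) (τ := τ) (β := β) hA h)
  refine IsLeast.csInf_eq ⟨⟨Xstar lam A τ β h, hX, by simp only; ring⟩, ?_⟩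
  rintro _ ⟨x, hx, rfl⟩
  have h1 := Xstar_optimality hA hα h (abs_le.2 hx)
  have e : β / (2 * τ) + lam = β * (1 / τ + 2 * lam / β) / 2 := by
    rw [mul_add, mul_div_cancel₀ _ hβ.ne', add_div, mul_one_div, div_div, mul_comm 2 τ]
    ring
  simp only
  have e2 : β / (2 * τ) * x ^ 2 + lam * x ^ 2 - β * h * x =
    β * (1 / τ + 2 * lam / β) / 2 * x ^ 2 - β * h * x := by rw [← e]; ring
  rw [e, e2]
  set α := 1 / τ + 2 * lam / β
  set X := Xstar lam A τ β h
  have h2 : 0 ≤ β * ((α * X - h) * (x - X)) := mul_nonneg hβ.le h1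
  have h3 : 0 ≤ β * α * (x - X) ^ 2 := by positivity
  nlinarith

lemma integrable_id_gaussian : Integrable (fun t : ℝ => t) (gaussianReal 0 1) :=
  gaussianReal_integrable_of_le (by fun_prop) 1 fun t => by
    rw [abs_le]; constructor <;> nlinarith [sq_nonneg (t - 1), sq_nonneg (t + 1)]

lemma integrable_Xstar_sq (hA : 0 < A) :
    Integrable (fun h => Xstar lam A τ β h ^ 2) (gaussianReal 0 1) :=
  Integrable.of_bound (continuous_Xstar.pow 2).aestronglyMeasurable (A ^ 2)
    (ae_of_all _ fun h => by
      rw [norm_eq_abs, abs_pow]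
      exact pow_le_pow_left₀ (abs_nonneg _) (abs_Xstar_le hA h) 2)

lemma integrable_mul_Xstar (hA : 0 < A) :
    Integrable (fun h => h * Xstar lam A τ β h) (gaussianReal 0 1) :=
  integrable_id_gaussian.mul_bdd (c := A) continuous_Xstar.aestronglyMeasurable
    (ae_of_all _ fun h => abs_Xstar_le hA h)

lemma phiFn_eq (hA : 0 < A) (hβ : 0 < β) (hα : 0 < 1 / τ + 2 * lam / β) :
    phiFn δ lam 1 A τ β = τ * β * δ / 2 + β / (2 * τ) - β ^ 2 / 4 +
      ∫ h, ((β / (2 * τ) + lam) * Xstar lam A τ β h ^ 2 - β * (h * Xstar lam A τ β h))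
        ∂(gaussianReal 0 1) := by
  unfold phiFn
  simp_rw [sInf_scalar hA hβ hα]
  rw [one_mul]

lemma integral_scalar (hA : 0 < A) (a τ' : ℝ) :
    ∫ h, (a * Xstar lam A τ' β h ^ 2 - β * (h * Xstar lam A τ' β h)) ∂(gaussianReal 0 1) =
      a * (∫ h, Xstar lam A τ' β h ^ 2 ∂(gaussianReal 0 1)) -
        β * ∫ h, h * Xstar lam A τ' β h ∂(gaussianReal 0 1) := by
  rw [integral_sub ((integrable_Xstar_sq hA).const_mul _) ((integrable_mul_Xstar hA).const_mul _),
    integral_const_mul, integral_const_mul]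

lemma saddle_stationary (hδ : 0 < δ) (hlam : 0 ≤ lam) (hA : 0 < A)
    (h : IsSaddle δ lam 1 A τ β) :
    δ * τ ^ 2 = 1 + ∫ h, Xstar lam A τ β h ^ 2 ∂(gaussianReal 0 1) := by
  obtain ⟨hτ, hβ, hmin, -⟩ := h
  have hα : ∀ t : ℝ, 0 < t → 0 < 1 / t + 2 * lam / β := fun t ht => by positivity
  set E := ∫ h, Xstar lam A τ β h ^ 2 ∂(gaussianReal 0 1) with hE
  have hE0 : 0 ≤ E := integral_nonneg fun h => sq_nonneg _
  have key : ∀ t : ℝ, 0 < t → τ * δ + (1 + E) / τ ≤ t * δ + (1 + E) / t := by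
    intro t ht
    have h1 := hmin t ht
    rw [phiFn_eq hA hβ (hα τ hτ), phiFn_eq hA hβ (hα t ht), integral_scalar hA] at h1
    have h2 : ∫ h, ((β / (2 * t) + lam) * Xstar lam A t β h ^ 2 - β * (h * Xstar lam A t β h))
        ∂(gaussianReal 0 1) ≤ ∫ h, ((β / (2 * t) + lam) * Xstar lam A τ β h ^ 2 -
          β * (h * Xstar lam A τ β h)) ∂(gaussianReal 0 1) := by
      refine integral_mono (((integrable_Xstar_sq hA).const_mul _).sub
        ((integrable_mul_Xstar hA).const_mul _)) (((integrable_Xstar_sq hA).const_mul _).sub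
        ((integrable_mul_Xstar hA).const_mul _)) fun h => ?_
      simp only
      rw [← sInf_scalar hA hβ (hα t ht) h]
      refine csInf_le ⟨(β / (2 * t) + lam) * Xstar lam A t β h ^ 2 - β * (h * Xstar lam A t β h),
        ?_⟩ ⟨Xstar lam A τ β h, abs_le.1 (abs_Xstar_le hA h), by simp only; ring⟩
      rintro _ ⟨x, hx, rfl⟩
      rw [← sInf_scalar hA hβ (hα t ht) h]
      refine csInf_le ?_ ⟨x, hx, rfl⟩
      exact (isCompact_Icc.image (by fun_prop)).bddBelow
    rw [integral_scalar hA _ τ, ← hE] at h2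
    rw [← hE] at h1
    have h3 : β / 2 * (τ * δ + (1 + E) / τ) ≤ β / 2 * (t * δ + (1 + E) / t) := by
      have e1 : β / 2 * (τ * δ + (1 + E) / τ) = τ * β * δ / 2 + β / (2 * τ) + β / (2 * τ) * E := by
        field_simp; ring
      have e2 : β / 2 * (t * δ + (1 + E) / t) = t * β * δ / 2 + β / (2 * t) + β / (2 * t) * E := by
        field_simp; ring
      rw [e1, e2]
      linarith
    exact le_of_mul_le_mul_left h3 (by positivity)
  have h1 := key (√((1 + E) / δ)) (by positivity)
  set t := √((1 + E) / δ) with ht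
  have ht0 : 0 < t := by positivity
  have ht2 : t ^ 2 * δ = 1 + E := by
    rw [ht, sq_sqrt (by positivity), div_mul_cancel₀ _ hδ.ne']
  rw [← ht2] at h1 ⊢
  have e1 : t * δ + t ^ 2 * δ / t = 2 * t * δ := by field_simp; ring
  have e2 : τ * δ + t ^ 2 * δ / τ = 2 * t * δ + δ * (τ - t) ^ 2 / τ := by field_simp; ring
  rw [e1, e2] at h1
  have h4 : δ * (τ - t) ^ 2 / τ ≤ 0 := by linarith
  have h5 : δ * (τ - t) ^ 2 ≤ 0 := by
    by_contra hc
    push Not at hc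
    exact absurd h4 (not_le.2 (by positivity))
  have h6 : (τ - t) ^ 2 ≤ 0 := by
    by_contra hc
    push Not at hc
    exact absurd h5 (not_le.2 (by positivity))
  have h7 : τ - t = 0 := by nlinarith [sq_nonneg (τ - t)]
  have : τ = t := by linarith
  rw [this]
  ring

lemma saddle_value (hδ : 0 < δ) (hlam : 0 ≤ lam) (hA : 0 < A) (h : IsSaddle δ lam 1 A τ β) :
    phiFn δ lam 1 A τ β + β ^ 2 / 4 =
      β / τ + (β / τ + lam) * (∫ h, Xstar lam A τ β h ^ 2 ∂(gaussianReal 0 1)) -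
        β * ∫ h, h * Xstar lam A τ β h ∂(gaussianReal 0 1) := by
  have h1 := saddle_stationary hδ hlam hA h
  obtain ⟨hτ, hβ, -, -⟩ := h
  rw [phiFn_eq hA hβ (by positivity), integral_scalar hA]
  set E := ∫ h, Xstar lam A τ β h ^ 2 ∂(gaussianReal 0 1)
  have e : τ * β * δ / 2 = β * (1 + E) / (2 * τ) := by rw [← h1]; field_simp
  rw [e]
  field_simp
  ring

lemma Xstar_sq_integral_pos (hA : 0 < A) (hα : 0 < 1 / τ + 2 * lam / β) :
    0 < ∫ h, Xstar lam A τ β h ^ 2 ∂(gaussianReal 0 1) := by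
  refine lt_of_le_of_ne (integral_nonneg fun h => sq_nonneg _) fun h0 => ?_
  have h1 := (integral_eq_zero_iff_of_nonneg (fun h => sq_nonneg _) (integrable_Xstar_sq hA)).1
    h0.symm
  have h2 : (fun t : ℝ => t ^ 2) =ᵐ[gaussianReal 0 1] fun _ => 0 := by
    filter_upwards [h1] with h hh
    have hz : Xstar lam A τ β h = 0 := by simpa using hh
    have := Xstar_eq_div hA (h := h) (by rw [hz]; simpa using hA)
    rw [hz] at this
    have : h = 0 := by
      rcases div_eq_zero_iff.1 this.symm with h3 | h3
      · exact h3
      · exact absurd h3 hα.ne'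
    simp [this]
  have := integral_congr_ae h2
  rw [gaussianReal_integral_sq] at this
  simp at this

end Scalar

section AuxiliaryOptimization

lemma sqrt_ge_sub_div {T a c : ℝ} (ha : 0 < a) (hc : 0 < c) (hca : c ≤ a) :
    √a - |T - a| / √c ≤ √T := by
  have hsa : 0 < √a := sqrt_pos.2 ha
  have hsc : 0 < √c := sqrt_pos.2 hc
  have h1 : √a - |T - a| / √a ≤ √T := by
    rcases le_total a T with h | h
    · have := sqrt_le_sqrt h
      have : 0 ≤ |T - a| / √a := by positivity
      linarith
    · rw [abs_of_nonpos (by linarith), sub_le_iff_le_add]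
      have h2 : √a * √a = a := mul_self_sqrt ha.le
      rcases le_total 0 T with hT | hT
      · have h3 : √T * √T = T := mul_self_sqrt hT
        have h4 := sqrt_le_sqrt h
        have h5 := sqrt_nonneg T
        rw [← sub_le_iff_le_add', le_div_iff₀ hsa]
        nlinarith
      · rw [sqrt_eq_zero_of_nonpos hT, zero_add, le_div_iff₀ hsa]
        linarith
  have h2 : |T - a| / √a ≤ |T - a| / √c :=
    div_le_div_of_nonneg_left (abs_nonneg _) hsc (sqrt_le_sqrt hca)
  linarith

lemma norm_residual_ge {J : Type*} [Fintype J] {s g : J → ℝ} {δ A r N : ℝ} (hs : ∀ k, s k ^ 2 = 1)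
    (hN : 0 < N) (hδ : 0 < δ) (hm : (Fintype.card J : ℝ) = δ * N) (hr : 0 ≤ r) (hrA : r ≤ A) :
    √δ * √(1 + r ^ 2) - (A ^ 2 * |(∑ l, g l ^ 2) / N - δ| + 2 * A * |(∑ l, g l * s l) / N|) / √δ ≤
      √(∑ l, (r * g l - s l) ^ 2) / √N := by
  rw [← sqrt_mul hδ.le, ← sqrt_div' _ hN.le]
  have e : ∑ l, (r * g l - s l) ^ 2 = r ^ 2 * ∑ l, g l ^ 2 - 2 * r * ∑ l, g l * s l + δ * N := by
    rw [← hm, Finset.mul_sum, Finset.mul_sum, ← Finset.sum_sub_distrib]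
    have : (Fintype.card J : ℝ) = ∑ l, s l ^ 2 := by simp [hs]
    rw [this, ← Finset.sum_add_distrib]
    exact Finset.sum_congr rfl fun _ _ => by ring
  have e2 : (∑ l, (r * g l - s l) ^ 2) / N - δ * (1 + r ^ 2) =
      r ^ 2 * ((∑ l, g l ^ 2) / N - δ) - 2 * r * ((∑ l, g l * s l) / N) := by
    rw [e]; field_simp; ring
  have h1 := sqrt_ge_sub_div (T := (∑ l, (r * g l - s l) ^ 2) / N) (a := δ * (1 + r ^ 2)) (c := δ)
    (by positivity) hδ (by nlinarith [sq_nonneg r])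
  rw [e2] at h1
  refine le_trans (sub_le_sub_left ((div_le_div_iff_of_pos_right (sqrt_pos.2 hδ)).2 ?_) _) h1
  refine (abs_sub _ _).trans (add_le_add ?_ ?_)
  · rw [abs_mul, abs_of_nonneg (sq_nonneg r)]
    exact mul_le_mul_of_nonneg_right (pow_le_pow_left₀ hr hrA 2) (abs_nonneg _)
  · rw [abs_mul, abs_of_nonneg (by positivity)]
    exact mul_le_mul_of_nonneg_right (by linarith) (abs_nonneg _)

lemma sqrt_one_add_strong_convex {A r2 U E Y : ℝ} (hr2 : 0 ≤ r2) (hr2A : r2 ≤ A ^ 2)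
    (hE0 : 0 ≤ E) (hEA : E ≤ A ^ 2) (hY : Y ^ 2 ≤ r2 * U) (hw : 0 ≤ r2 + U - 2 * Y) :
    (1 + Y) / √(1 + E) + (r2 + U - 2 * Y) / (2 * (1 + A ^ 2) * √(1 + E)) -
      (1 + A ^ 2) / 2 * |U - E| ≤ √(1 + r2) := by
  set p := √(1 + r2) with hp
  set p0 := √(1 + E) with hp0
  have hp1 : 1 ≤ p := one_le_sqrt.2 (by linarith)
  have hq1 : 1 ≤ p0 := one_le_sqrt.2 (by linarith)
  have hp2 : p ^ 2 = 1 + r2 := sq_sqrt (by linarith)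
  have hq2 : p0 ^ 2 = 1 + E := sq_sqrt (by linarith)
  set K := 1 + A ^ 2 with hK
  have hK1 : 1 ≤ K := by nlinarith [sq_nonneg A]
  set d := |U - E| with hd
  have hd0 : 0 ≤ d := abs_nonneg _
  have hdl : -(d) ≤ E - U := by have := le_abs_self (U - E); linarith
  set a := p * p0 with ha
  have ha1 : 1 ≤ a := one_le_mul_of_one_le_of_one_le hp1 hq1
  have ha2 : a ^ 2 = (1 + r2) * (1 + E) := by rw [ha, mul_pow, hp2, hq2]
  have haK : a ≤ K := by
    refine abs_le_of_sq_le_sq' ?_ (by linarith) |>.2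
    rw [ha2, sq]
    exact mul_le_mul (by linarith) (by linarith) (by linarith) (by linarith)
  set w := r2 + U - 2 * Y with hwd
  have h1 : w - d * K ≤ a ^ 2 - (1 + Y) ^ 2 := by
    rw [ha2]
    nlinarith
  have h2 : w - d * K ≤ 2 * a * (a - (1 + Y)) := by nlinarith [sq_nonneg (a - (1 + Y))]
  have h3 : a * (w / K) ≤ w := by
    rw [← mul_div_assoc, div_le_iff₀ (by linarith)]
    nlinarith
  have h4 : 0 ≤ 2 * a * (a - (1 + Y) - w / K / 2 + d * K / 2) := by
    have : 0 ≤ (a - 1) * (d * K) := mul_nonneg (by linarith) (mul_nonneg hd0 (by linarith))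
    nlinarith
  have h5 : 0 ≤ a - (1 + Y) - w / K / 2 + d * K / 2 := by
    by_contra hc
    push Not at hc
    exact absurd h4 (not_le.2 (mul_neg_of_pos_of_neg (by linarith) hc))
  have h6 : (1 + Y) / p0 + w / (2 * K * p0) - d * K / 2 / p0 ≤ p := by
    have : p = a / p0 := by rw [ha]; field_simp
    rw [this, show (1 + Y) / p0 + w / (2 * K * p0) - d * K / 2 / p0 =
      (1 + Y + w / K / 2 - d * K / 2) / p0 by field_simp]
    exact (div_le_div_iff_of_pos_right (by linarith)).2 (by linarith)
  have h7 : d * K / 2 / p0 ≤ d * K / 2 := div_le_self (by positivity) hq1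
  linarith

/-- Deterministic lower bound on the auxiliary objective. -/
lemma auxiliary_objective_ge {I J : Type*} [Fintype I] [Fintype J] {s g : J → ℝ} {h x : I → ℝ}
    {δ lam A τ β E N : ℝ} (hs : ∀ k, s k ^ 2 = 1) (hN : (Fintype.card I : ℝ) = N) (hN0 : 0 < N)
    (hm : (Fintype.card J : ℝ) = δ * N) (hδ : 0 < δ) (hlam : 0 ≤ lam) (hA : 0 < A) (hτ : 0 < τ)
    (hβ : 0 < β) (hE : δ * τ ^ 2 = 1 + E) (hE0 : 0 ≤ E) (hEA : E ≤ A ^ 2) (hx : ∀ i, |x i| ≤ A) :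
    β / τ + (β / τ + lam) * ((∑ i, Xstar lam A τ β (h i) ^ 2) / N) -
        β * ((∑ i, h i * Xstar lam A τ β (h i)) / N) +
        β / (2 * (1 + A ^ 2) * τ) * ((∑ i, (x i - Xstar lam A τ β (h i)) ^ 2) / N) -
        β * √δ * (1 + A ^ 2) / 2 * |(∑ i, Xstar lam A τ β (h i) ^ 2) / N - E| -
        β / √δ * (A ^ 2 * |(∑ l, g l ^ 2) / N - δ| + 2 * A * |(∑ l, g l * s l) / N|) ≤
      β / √N * (√(∑ l, (√(∑ i, (x i / √N) ^ 2) * g l - s l) ^ 2) - ∑ i, x i / √N * h i) +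
        lam * ∑ i, (x i / √N) ^ 2 := by
  set X : I → ℝ := fun i => Xstar lam A τ β (h i) with hX
  have hα : 0 < 1 / τ + 2 * lam / β := by positivity
  have hXA : ∀ i, |X i| ≤ A := fun i => abs_Xstar_le hA _
  have hsN : √N * √N = N := mul_self_sqrt hN0.le
  have hsN0 : 0 < √N := sqrt_pos.2 hN0
  have hsδ : 0 < √δ := sqrt_pos.2 hδ
  set r2 := ∑ i, (x i / √N) ^ 2 with hr2
  set U := (∑ i, X i ^ 2) / N with hU
  set V := (∑ i, h i * X i) / N with hV
  set Y := (∑ i, x i * X i) / N with hYd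
  set w := (∑ i, (x i - X i) ^ 2) / N with hw
  set G1 := |(∑ l, g l ^ 2) / N - δ|
  set G2 := |(∑ l, g l * s l) / N|
  have r2e : r2 = (∑ i, x i ^ 2) / N := by
    rw [hr2, Finset.sum_div]
    exact Finset.sum_congr rfl fun i _ => by rw [div_pow, sq_sqrt hN0.le]
  have r20 : 0 ≤ r2 := by positivity
  have r2A : r2 ≤ A ^ 2 := by
    rw [r2e, div_le_iff₀ hN0, ← hN]
    have := Finset.sum_le_card_nsmul Finset.univ (fun i => x i ^ 2) (A ^ 2)
      fun i _ => sq_le_sq.2 ((hx i).trans (le_abs_self A))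
    simpa [mul_comm] using this
  have we : w = r2 + U - 2 * Y := by
    rw [hw, r2e, hU, hYd, ← mul_div_assoc, ← add_div, ← sub_div, Finset.mul_sum,
      ← Finset.sum_add_distrib, ← Finset.sum_sub_distrib]
    congr 1
    exact Finset.sum_congr rfl fun _ _ => by ring
  have w0 : 0 ≤ w := by positivity
  have hYc : Y ^ 2 ≤ r2 * U := by
    rw [hYd, r2e, hU, div_pow, div_mul_div_comm, ← sq]
    exact (div_le_div_iff_of_pos_right (by positivity)).2 (Finset.sum_mul_sq_le_sq_mul_sq _ _ _)
  have hp0 : √(1 + E) = √δ * τ := by rw [← hE, sqrt_mul hδ.le, sqrt_sq hτ.le]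
  have h1 := sqrt_one_add_strong_convex r20 r2A hE0 hEA hYc (we ▸ w0)
  rw [← we, hp0] at h1
  have h2 := norm_residual_ge (g := g) (r := √r2) (A := A) hs hN0 hδ hm (sqrt_nonneg _)
    (sqrt_le_iff.2 ⟨hA.le, r2A⟩)
  rw [sq_sqrt r20] at h2
  have h3 : ∑ i, x i / √N * h i = (∑ i, x i * h i) / √N := by
    rw [Finset.sum_div]
    exact Finset.sum_congr rfl fun _ _ => by ring
  have h4 : 0 ≤ ((1 / τ + 2 * lam / β) * Y - (∑ i, x i * h i) / N) -
      ((1 / τ + 2 * lam / β) * U - V) := by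
    have : ((1 / τ + 2 * lam / β) * Y - (∑ i, x i * h i) / N) -
      ((1 / τ + 2 * lam / β) * U - V) =
        (∑ i, ((1 / τ + 2 * lam / β) * X i - h i) * (x i - X i)) / N := by
      rw [hYd, hU, hV, ← mul_div_assoc, ← mul_div_assoc, ← sub_div, ← sub_div, ← sub_div,
        Finset.mul_sum, Finset.mul_sum, ← Finset.sum_sub_distrib, ← Finset.sum_sub_distrib,
        ← Finset.sum_sub_distrib]
      congr 1
      exact Finset.sum_congr rfl fun _ _ => by ring
    rw [this]
    exact div_nonneg (Finset.sum_nonneg fun i _ => Xstar_optimality hA hα _ (hx i)) hN0.le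
  have h5 : 0 ≤ β * (((1 / τ + 2 * lam / β) * Y - (∑ i, x i * h i) / N) -
      ((1 / τ + 2 * lam / β) * U - V)) := mul_nonneg hβ.le h4
  have e5 : β * (((1 / τ + 2 * lam / β) * Y - (∑ i, x i * h i) / N) -
      ((1 / τ + 2 * lam / β) * U - V)) =
      β / τ * Y + 2 * lam * Y - β * ((∑ i, x i * h i) / N) - β / τ * U - 2 * lam * U + β * V := by
    field_simp
    ring
  rw [e5] at h5
  have h6 : 0 ≤ lam * w := mul_nonneg hlam w0
  rw [we] at h6
  have h7 := mul_le_mul_of_nonneg_left h1 (mul_nonneg hβ.le hsδ.le)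
  have e7 : β * √δ * ((1 + Y) / (√δ * τ) + w / (2 * (1 + A ^ 2) * (√δ * τ)) -
      (1 + A ^ 2) / 2 * |U - E|) = β / τ + β / τ * Y + β / (2 * (1 + A ^ 2) * τ) * w -
        β * √δ * (1 + A ^ 2) / 2 * |U - E| := by
    field_simp
  rw [e7] at h7
  have h8 := mul_le_mul_of_nonneg_left h2 hβ.le
  have e8 : β / √N * (√(∑ l, (√r2 * g l - s l) ^ 2) - ∑ i, x i / √N * h i) =
      β * (√(∑ l, (√r2 * g l - s l) ^ 2) / √N) - β * ((∑ i, x i * h i) / N) := by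
    have : ∀ S, β / √N * (S / √N) = β * (S / N) := fun S => by
      rw [div_mul_div_comm, hsN, mul_div_assoc]
    rw [h3, mul_sub, this]
    ring
  rw [e8]
  have e9 : β * (√δ * √(1 + r2) - (A ^ 2 * G1 + 2 * A * G2) / √δ) =
      β * √δ * √(1 + r2) - β / √δ * (A ^ 2 * G1 + 2 * A * G2) := by
    field_simp
  rw [e9] at h8
  linarith

end AuxiliaryOptimization

section SmallBall

lemma gaussianPDFReal_le_one (t : ℝ) : gaussianPDFReal 0 1 t ≤ 1 := by
  unfold gaussianPDFReal
  have h1 : (√(2 * π * (1 : ℝ≥0)))⁻¹ ≤ 1 := by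
    refine inv_le_one_of_one_le₀ (one_le_sqrt.2 ?_)
    have := pi_gt_three
    push_cast
    linarith
  have h2 : exp (-(t - 0) ^ 2 / (2 * (1 : ℝ≥0))) ≤ 1 := by
    refine exp_le_one_iff.2 ?_
    push_cast
    nlinarith [sq_nonneg (t - 0)]
  exact mul_le_one₀ h1 (exp_pos _).le h2

lemma gaussianPDFReal_ge {t : ℝ} (ht : |t| ≤ 1) : gaussianPDFReal 0 1 1 ≤ gaussianPDFReal 0 1 t := by
  unfold gaussianPDFReal
  refine mul_le_mul_of_nonneg_left (exp_le_exp.2 ?_) (by positivity)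
  have := sq_abs t
  have : |t| ^ 2 ≤ 1 := pow_le_one₀ (abs_nonneg _) ht
  push_cast
  linarith

lemma gaussianReal_real_eq (a : ℝ) :
    (gaussianReal 0 1).real {t | |t| < a} = ∫ t in Set.Ioo (-a) a, gaussianPDFReal 0 1 t := by
  have e : {t : ℝ | |t| < a} = Set.Ioo (-a) a := by
    ext t; simp [abs_lt]
  rw [e, measureReal_def, gaussianReal_apply_eq_integral _ one_ne_zero,
    ENNReal.toReal_ofReal (integral_nonneg fun t => gaussianPDFReal_nonneg _ _ _)]

lemma gaussianReal_real_abs_lt_le {a : ℝ} (ha : 0 ≤ a) :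
    (gaussianReal 0 1).real {t | |t| < a} ≤ 2 * a := by
  rw [gaussianReal_real_eq]
  have h := setIntegral_mono_on (μ := volume) (s := Set.Ioo (-a) a) (g := fun _ => (1 : ℝ))
    (integrable_gaussianPDFReal 0 1).integrableOn (by simp) measurableSet_Ioo
    fun t _ => gaussianPDFReal_le_one t
  refine h.trans (le_of_eq ?_)
  simp [ha]
  ring

lemma gaussianReal_real_abs_lt_ge {a : ℝ} (ha : 0 ≤ a) (ha1 : a ≤ 1) :
    2 * a * gaussianPDFReal 0 1 1 ≤ (gaussianReal 0 1).real {t | |t| < a} := by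
  rw [gaussianReal_real_eq]
  have h := setIntegral_mono_on (μ := volume) (s := Set.Ioo (-a) a)
    (f := fun _ => gaussianPDFReal 0 1 1) (by simp)
    (integrable_gaussianPDFReal 0 1).integrableOn measurableSet_Ioo
    fun t ht => gaussianPDFReal_ge (abs_le.2 ⟨by linarith [ht.1], by linarith [ht.2]⟩)
  refine le_trans (le_of_eq ?_) h
  simp [ha]
  left
  ring

end SmallBall

section Stability

lemma ncard_eq_sum {I : Type*} [Fintype I] (x : I → ℝ) (η : ℝ) :
    (Set.ncard {i | x i ∈ Set.Ioo (-η) η} : ℝ) =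
      ∑ i, Set.indicator {t : ℝ | |t| < η} (fun _ => (1 : ℝ)) (x i) := by
  classical
  rw [Set.ncard_eq_toFinset_card']
  simp [Set.indicator_apply, Finset.sum_boole, abs_lt]

lemma sum_abs_div_le {I : Type*} [Fintype I] (u : I → ℝ) {N : ℝ} (hN : (Fintype.card I : ℝ) = N)
    (hN0 : 0 < N) : (∑ i, |u i|) / N ≤ √((∑ i, u i ^ 2) / N) := by
  refine le_sqrt_of_sq_le ?_
  rw [div_pow, div_le_div_iff₀ (by positivity) hN0]
  have := sq_sum_le_card_mul_sum_sq (s := Finset.univ) (f := fun i => |u i|)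
  simp only [sq_abs, Finset.card_univ, hN] at this
  nlinarith

lemma sqrt_sum_sq_sub_le {I : Type*} [Fintype I] (x X : I → ℝ) {N : ℝ} (hN0 : 0 < N) :
    |√(∑ i, x i ^ 2) / √N - √((∑ i, X i ^ 2) / N)| ≤ √((∑ i, (x i - X i) ^ 2) / N) := by
  rw [sqrt_div' _ hN0.le, sqrt_div' _ hN0.le, ← sub_div, abs_div, abs_of_pos (sqrt_pos.2 hN0)]
  refine (div_le_div_iff_of_pos_right (sqrt_pos.2 hN0)).2 ?_
  have h := abs_norm_sub_norm_le (WithLp.toLp 2 x : EuclideanSpace ℝ I) (WithLp.toLp 2 X)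
  simpa [EuclideanSpace.norm_eq] using h

lemma indicator_ge {α η x X h : ℝ} (hα : 0 < α) (hη : 0 < η) (hX : |X| ≤ |h| / α) :
    Set.indicator {t : ℝ | |t| < α * η / 2} (fun _ => (1 : ℝ)) h - 4 / η ^ 2 * (x - X) ^ 2 ≤
      Set.indicator {t : ℝ | |t| < η} (fun _ => (1 : ℝ)) x := by
  have h0 : 0 ≤ 4 / η ^ 2 * (x - X) ^ 2 := by positivity
  by_cases h1 : |h| < α * η / 2
  · rw [Set.indicator_of_mem (s := {t : ℝ | |t| < α * η / 2}) h1]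
    by_cases h2 : |x| < η
    · rw [Set.indicator_of_mem (s := {t : ℝ | |t| < η}) h2]
      linarith
    · rw [Set.indicator_of_notMem (s := {t : ℝ | |t| < η}) h2]
      push Not at h2
      have h3 : |h| / α < η / 2 := by
        rw [div_lt_iff₀ hα]; linarith
      have h4 := abs_sub_abs_le_abs_sub x X
      have h5 : (η / 2) ^ 2 ≤ (x - X) ^ 2 := by
        rw [← sq_abs (x - X)]
        exact pow_le_pow_left₀ (by linarith) (by linarith) 2
      rw [sub_nonpos, div_mul_eq_mul_div, le_div_iff₀ (by positivity)]
      linarith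
  · rw [Set.indicator_of_notMem (s := {t : ℝ | |t| < α * η / 2}) h1]
    have : 0 ≤ Set.indicator {t : ℝ | |t| < η} (fun _ => (1 : ℝ)) x :=
      Set.indicator_nonneg (fun _ _ => zero_le_one) _
    linarith

lemma indicator_le {α A η x X h : ℝ} (hη : 0 < η) (hηA : 2 * η ≤ A) (hα : 0 < α)
    (hX : |X| < A → X = h / α) :
    Set.indicator {t : ℝ | |t| < η} (fun _ => (1 : ℝ)) x ≤
      Set.indicator {t : ℝ | |t| < α * (2 * η)} (fun _ => (1 : ℝ)) h + 1 / η ^ 2 * (x - X) ^ 2 := by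
  have h0 : 0 ≤ 1 / η ^ 2 * (x - X) ^ 2 := by positivity
  by_cases h1 : |h| < α * (2 * η)
  · rw [Set.indicator_of_mem (s := {t : ℝ | |t| < α * (2 * η)}) h1]
    have : Set.indicator {t : ℝ | |t| < η} (fun _ => (1 : ℝ)) x ≤ 1 :=
      Set.indicator_le_self' (fun _ _ => zero_le_one) _
    linarith
  · rw [Set.indicator_of_notMem (s := {t : ℝ | |t| < α * (2 * η)}) h1]
    by_cases h2 : |x| < η
    · rw [Set.indicator_of_mem (s := {t : ℝ | |t| < η}) h2]
      have h3 : 2 * η ≤ |X| := by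
        by_contra hc
        push Not at hc
        have := hX (by linarith)
        rw [this, abs_div, abs_of_pos hα, div_lt_iff₀ hα] at hc
        exact h1 (by linarith)
      have h4 := abs_sub_abs_le_abs_sub X x
      rw [abs_sub_comm] at h4
      have h5 : η ^ 2 ≤ (x - X) ^ 2 := by
        rw [← sq_abs (x - X)]
        exact pow_le_pow_left₀ hη.le (by linarith) 2
      rw [zero_add, div_mul_eq_mul_div, le_div_iff₀ (by positivity)]
      linarith
    · rw [Set.indicator_of_notMem (s := {t : ℝ | |t| < η}) h2]
      linarith

/-- Vectors close to the empirical optimizer inherit its statistics. -/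
lemma statistics_of_close {I : Type*} [Fintype I] {x X h : I → ℝ} {α A L N ε κ c D M E p q : ℝ}
    (hN : (Fintype.card I : ℝ) = N) (hN0 : 0 < N) (hα : 0 < α) (hL : 0 < L) (hε : 0 < ε)
    (hκ : 0 < κ) (hκc : κ ^ 2 = c * L ^ 2 / 16) (hc : 0 < c) (hE : 0 < E)
    (hεA : 2 * (L * ε ^ 2) ≤ A) (hX1 : ∀ i, |X i| ≤ |h i| / α) (hX2 : ∀ i, |X i| < A → X i = h i / α)
    (hp : c * ε ^ 2 ≤ p) (hq : q ≤ D * ε ^ 2)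
    (hw : (∑ i, (x i - X i) ^ 2) / N ≤ κ ^ 2 * ε ^ 6)
    (h1 : |(∑ i, |X i|) / N - M| ≤ ε ^ 3) (h2 : |(∑ i, X i ^ 2) / N - E| ≤ ε ^ 3)
    (h3 : |(∑ i, Set.indicator {t : ℝ | |t| < α * (L * ε ^ 2) / 2} (fun _ => (1 : ℝ)) (h i)) / N - p|
      ≤ c / 4 * ε ^ 2)
    (h4 : |(∑ i, Set.indicator {t : ℝ | |t| < α * (2 * (L * ε ^ 2))} (fun _ => (1 : ℝ)) (h i)) / N -
      q| ≤ c / 4 * ε ^ 2) :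
    |(∑ i, |x i|) / N - M| ≤ (κ + 1) * ε ^ 3 ∧
    |√(∑ i, x i ^ 2) / √N - √E| ≤ (κ + 1 / √E) * ε ^ 3 ∧
    c / 2 * N * ε ^ 2 ≤ (Set.ncard {i | x i ∈ Set.Ioo (-(L * ε ^ 2)) (L * ε ^ 2)} : ℝ) ∧
    (Set.ncard {i | x i ∈ Set.Ioo (-(L * ε ^ 2)) (L * ε ^ 2)} : ℝ) ≤ (D + c) * N * ε ^ 2 := by
  have hsw : √((∑ i, (x i - X i) ^ 2) / N) ≤ κ * ε ^ 3 := by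
    refine sqrt_le_iff.2 ⟨by positivity, hw.trans (le_of_eq (by ring))⟩
  have hη : 0 < L * ε ^ 2 := by positivity
  have hsE : 0 < √E := sqrt_pos.2 hE
  refine ⟨?_, ?_, ?_, ?_⟩
  · have h5 := sum_abs_div_le (fun i => x i - X i) hN hN0
    have h6 : |(∑ i, |x i|) / N - (∑ i, |X i|) / N| ≤ (∑ i, |x i - X i|) / N := by
      rw [← sub_div, abs_div, abs_of_pos hN0, ← Finset.sum_sub_distrib]
      exact (div_le_div_iff_of_pos_right hN0).2 ((Finset.abs_sum_le_sum_abs _ _).trans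
        (Finset.sum_le_sum fun i _ => abs_abs_sub_abs_le _ _))
    have h7 := abs_sub_le ((∑ i, |x i|) / N) ((∑ i, |X i|) / N) M
    linarith
  · have h5 := sqrt_sum_sq_sub_le x X hN0
    have h6 : |√((∑ i, X i ^ 2) / N) - √E| ≤ 1 / √E * ε ^ 3 := by
      have hU : 0 ≤ (∑ i, X i ^ 2) / N := by positivity
      have e : |(∑ i, X i ^ 2) / N - E| =
          |√((∑ i, X i ^ 2) / N) - √E| * (√((∑ i, X i ^ 2) / N) + √E) := by
        rw [← abs_of_nonneg (add_nonneg (sqrt_nonneg ((∑ i, X i ^ 2) / N)) (sqrt_nonneg E)),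
          ← abs_mul]
        congr 1
        nlinarith [mul_self_sqrt hU, mul_self_sqrt hE.le]
      have h7 : |√((∑ i, X i ^ 2) / N) - √E| * √E ≤ ε ^ 3 := by
        refine le_trans ?_ h2
        rw [e]
        exact mul_le_mul_of_nonneg_left (by linarith [sqrt_nonneg ((∑ i, X i ^ 2) / N)])
          (abs_nonneg _)
      rw [one_div, inv_mul_eq_div, le_div_iff₀ hsE]
      exact h7
    have h7 := abs_sub_le (√(∑ i, x i ^ 2) / √N) (√((∑ i, X i ^ 2) / N)) (√E)
    linarith
  · rw [ncard_eq_sum]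
    have h5 : ∑ i, Set.indicator {t : ℝ | |t| < α * (L * ε ^ 2) / 2} (fun _ => (1 : ℝ)) (h i) -
        4 / (L * ε ^ 2) ^ 2 * ∑ i, (x i - X i) ^ 2 ≤
        ∑ i, Set.indicator {t : ℝ | |t| < L * ε ^ 2} (fun _ => (1 : ℝ)) (x i) := by
      rw [Finset.mul_sum, ← Finset.sum_sub_distrib]
      exact Finset.sum_le_sum fun i _ => indicator_ge hα hη (hX1 i)
    have h6 : 4 / (L * ε ^ 2) ^ 2 * ∑ i, (x i - X i) ^ 2 ≤ c / 4 * ε ^ 2 * N := by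
      rw [div_le_iff₀ hN0, hκc] at hw
      rw [div_mul_eq_mul_div, div_le_iff₀ (by positivity)]
      calc 4 * ∑ i, (x i - X i) ^ 2 ≤ 4 * (c * L ^ 2 / 16 * ε ^ 6 * N) := by linarith
        _ = _ := by ring
    have h7 := (abs_le.1 h3).1
    have h8 := (sub_le_iff_le_add.1 (sub_le_sub_right hp (c / 4 * ε ^ 2)))
    have h9 : c * ε ^ 2 - c / 4 * ε ^ 2 ≤
        (∑ i, Set.indicator {t : ℝ | |t| < α * (L * ε ^ 2) / 2} (fun _ => (1 : ℝ)) (h i)) / N := by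
      linarith
    rw [le_div_iff₀ hN0] at h9
    nlinarith
  · rw [ncard_eq_sum]
    have h5 : ∑ i, Set.indicator {t : ℝ | |t| < L * ε ^ 2} (fun _ => (1 : ℝ)) (x i) ≤
        ∑ i, Set.indicator {t : ℝ | |t| < α * (2 * (L * ε ^ 2))} (fun _ => (1 : ℝ)) (h i) +
        1 / (L * ε ^ 2) ^ 2 * ∑ i, (x i - X i) ^ 2 := by
      rw [Finset.mul_sum, ← Finset.sum_add_distrib]
      exact Finset.sum_le_sum fun i _ => indicator_le hη hεA hα (hX2 i)
    have h6 : 1 / (L * ε ^ 2) ^ 2 * ∑ i, (x i - X i) ^ 2 ≤ c / 16 * ε ^ 2 * N := by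
      rw [div_le_iff₀ hN0, hκc] at hw
      rw [div_mul_eq_mul_div, div_le_iff₀ (by positivity)]
      calc 1 * ∑ i, (x i - X i) ^ 2 ≤ (c * L ^ 2 / 16 * ε ^ 6 * N) := by linarith
        _ = _ := by ring
    have h7 := (abs_le.1 h4).2
    have h9 : (∑ i, Set.indicator {t : ℝ | |t| < α * (2 * (L * ε ^ 2))} (fun _ => (1 : ℝ)) (h i)) / N
        ≤ D * ε ^ 2 + c / 4 * ε ^ 2 := by
      linarith
    rw [div_le_iff₀ hN0] at h9
    have : 0 ≤ c * ε ^ 2 * N := by positivity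
    nlinarith

end Stability

section Fluctuation

variable {ι κ : Type*} [Fintype ι] [Fintype κ]

/-- `Z` has mean square at most `C / N` and mean absolute value at most `(C + 1) / √N`. -/
structure IsFluctuation {Ω : Type*} [MeasurableSpace Ω] (μ : Measure Ω) (Z : Ω → ℝ) (C N : ℝ) :
    Prop where
  integrable_sq : Integrable (fun ω => Z ω ^ 2) μ
  integral_sq_le : ∫ ω, Z ω ^ 2 ∂μ ≤ C / N
  integrable_abs : Integrable (fun ω => |Z ω|) μ
  integral_abs_le : ∫ ω, |Z ω| ∂μ ≤ (C + 1) / √N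

lemma IsFluctuation.mono {Ω : Type*} [MeasurableSpace Ω] {μ : Measure Ω} {Z : Ω → ℝ} {C D N : ℝ}
    (h : IsFluctuation μ Z C N) (hN : 0 < N) (hCD : C ≤ D) : IsFluctuation μ Z D N := by
  refine ⟨h.1, h.2.trans ?_, h.3, h.4.trans ?_⟩ <;> gcongr

lemma isFluctuation_of_sq {Ω : Type*} [MeasurableSpace Ω] {μ : Measure Ω} [IsProbabilityMeasure μ]
    {Z : Ω → ℝ} {C N : ℝ} (hN : 0 < N) (hC : 0 ≤ C) (hZ : MemLp Z 2 μ)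
    (h : ∫ ω, Z ω ^ 2 ∂μ ≤ C / N) : IsFluctuation μ Z C N := by
  have h1 := hZ.integrable_sq
  have h2 : Integrable (fun ω => |Z ω|) μ := (hZ.integrable (by norm_num)).abs
  refine ⟨h1, h, h2, ?_⟩
  have hs : 0 < √N := sqrt_pos.2 hN
  have h3 : ∫ ω, |Z ω| ∂μ ≤ ∫ ω, (√N * Z ω ^ 2 + 1 / √N) ∂μ := by
    refine integral_mono h2 ((h1.const_mul _).add (integrable_const _)) fun ω => ?_
    have : √N * Z ω ^ 2 + 1 / √N - |Z ω| = 1 / √N * ((√N * |Z ω| - 1) ^ 2 + √N * |Z ω|) := by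
      rw [← sq_abs (Z ω)]
      field_simp
      ring
    have h4 : 0 ≤ 1 / √N * ((√N * |Z ω| - 1) ^ 2 + √N * |Z ω|) := by positivity
    dsimp only
    linarith
  refine h3.trans ?_
  rw [integral_add (h1.const_mul _) (integrable_const _), integral_const_mul]
  simp only [integral_const, probReal_univ, one_smul]
  calc √N * ∫ ω, Z ω ^ 2 ∂μ + 1 / √N ≤ √N * (C / N) + 1 / √N := by gcongr
    _ = (C + 1) / √N := by
      have : N = √N * √N := (mul_self_sqrt hN.le).symm
      rw [show √N * (C / N) = √N * (C / (√N * √N)) by rw [← this]]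
      field_simp

lemma isFluctuation_average {e : κ → ι} (he : Function.Injective e) {f : κ → ℝ → ℝ} {a C r N : ℝ}
    (hN : 0 < N) (hC : 0 ≤ C) (hr : (Fintype.card κ : ℝ) ≤ r * N)
    (hf : ∀ k, MemLp (f k) 2 (gaussianReal 0 1))
    (h2 : ∀ k, ∫ t, f k t ^ 2 ∂(gaussianReal 0 1) ≤ C)
    (ha : ∑ k, ∫ t, f k t ∂(gaussianReal 0 1) = a * N) :
    IsFluctuation (stdPi ι) (fun ω => (∑ k, f k (ω (e k))) / N - a) (r * C) N := by
  have hr0 : 0 ≤ r := by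
    by_contra h
    have : r * N < 0 := mul_neg_of_neg_of_pos (not_le.1 h) hN
    have := (Nat.cast_nonneg (α := ℝ) (Fintype.card κ))
    linarith
  have hmp := stdPi_measurePreserving_comp (ι := ι) he
  have hk : ∀ k, MemLp (fun η : κ → ℝ => f k (η k)) 2 (stdPi κ) := fun k =>
    (hf k).comp_measurePreserving (stdPi_measurePreserving_eval k)
  have hS : MemLp (fun η : κ → ℝ => ∑ k, f k (η k)) 2 (stdPi κ) :=
    memLp_finsetSum _ fun k _ => hk k
  have hZ : MemLp (fun η : κ → ℝ => (∑ k, f k (η k)) / N - a) 2 (stdPi κ) := by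
    refine MemLp.sub ?_ (memLp_const a)
    simp only [div_eq_inv_mul]
    exact hS.const_mul _
  have hint : ∀ k, ∫ η, f k (η k) ∂(stdPi κ) = ∫ t, f k t ∂(gaussianReal 0 1) := fun k => by
    have h := stdPi_measurePreserving_eval (ι := κ) k
    rw [← h.map_eq, integral_map h.measurable.aemeasurable]
    rw [h.map_eq]
    exact (hf k).1
  have hmean : ∫ η, ∑ k, f k (η k) ∂(stdPi κ) = a * N := by
    rw [integral_finsetSum _ fun k _ => (hk k).integrable (by norm_num), ← ha]
    exact Finset.sum_congr rfl fun k _ => hint k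
  refine isFluctuation_of_sq hN (by positivity) (hZ.comp_measurePreserving hmp) ?_
  have e1 : ∫ ω, ((∑ k, f k (ω (e k))) / N - a) ^ 2 ∂(stdPi ι) =
      ∫ η, ((∑ k, f k (η k)) / N - a) ^ 2 ∂(stdPi κ) := by
    rw [← hmp.map_eq, integral_map hmp.measurable.aemeasurable]
    rw [hmp.map_eq]
    exact hZ.integrable_sq.1
  have e2 : ∫ η, ((∑ k, f k (η k)) / N - a) ^ 2 ∂(stdPi κ) =
      Var[fun η : κ → ℝ => ∑ k, f k (η k); stdPi κ] / N ^ 2 := by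
    rw [variance_eq_integral hS.1.aemeasurable, hmean, ← integral_div]
    congr 1
    ext η
    field_simp
  have e3 : Var[fun η : κ → ℝ => ∑ k, f k (η k); stdPi κ] =
      ∑ k, Var[f k; gaussianReal 0 1] := by
    have := variance_sum_pi (μ := fun _ : κ => gaussianReal 0 1) (X := f) hf
    rw [← this]
    congr 1
    ext η
    simp
  rw [e1, e2, e3]
  have e4 : ∑ k, Var[f k; gaussianReal 0 1] ≤ r * N * C := by
    calc ∑ k, Var[f k; gaussianReal 0 1] ≤ ∑ _k : κ, C := Finset.sum_le_sum fun k _ =>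
          (variance_le_expectation_sq (hf k).1).trans (h2 k)
      _ = Fintype.card κ * C := by simp
      _ ≤ r * N * C := by gcongr
  calc _ ≤ r * N * C / N ^ 2 := by gcongr
    _ = r * C / N := by field_simp

end Fluctuation

section LowerBound

/-- The normalized `ℓ¹` norm is near `M`, the normalized `ℓ²` norm is near `r`, and the number of
coordinates of size less than `L ε²` is of order `N ε²`. -/
def IsTypical {I : Type*} [Fintype I] (M r Cx1 Cx2 Cl Cu L ε N : ℝ) (x : I → ℝ) : Prop :=
  |(∑ i, |x i|) / N - M| ≤ Cx1 * ε ^ 3 ∧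
    |√(∑ i, x i ^ 2) / √N - r| ≤ Cx2 * ε ^ 3 ∧
    Cl * N * ε ^ 2 ≤ (Set.ncard {i | x i ∈ Set.Ioo (-(L * ε ^ 2)) (L * ε ^ 2)} : ℝ) ∧
    (Set.ncard {i | x i ∈ Set.Ioo (-(L * ε ^ 2)) (L * ε ^ 2)} : ℝ) ≤ Cu * N * ε ^ 2

lemma le_mul_sq_of_lt_abs {a e z ε : ℝ} (ha : 0 ≤ a) (hε : 0 < ε)
    (h1 : ε ^ 3 ≤ a * e) (h : e < |z|) : ε ^ 6 ≤ a ^ 2 * z ^ 2 := by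
  have h2 : ε ^ 3 ≤ a * |z| := h1.trans (mul_le_mul_of_nonneg_left h.le ha)
  calc ε ^ 6 = (ε ^ 3) ^ 2 := by ring
    _ ≤ (a * |z|) ^ 2 := by gcongr
    _ = a ^ 2 * z ^ 2 := by rw [mul_pow, sq_abs]

lemma sq_dist_ge_of_not_isTypical {I : Type*} [Fintype I] {x X h : I → ℝ}
    {α A L N ε κ c D M E p q z1 z2 z3 z4 : ℝ}
    (hN : (Fintype.card I : ℝ) = N) (hN0 : 0 < N) (hα : 0 < α) (hL : 0 < L) (hε : 0 < ε)
    (hε1 : ε < 1)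
    (hκ : 0 < κ) (hκc : κ ^ 2 = c * L ^ 2 / 16) (hc : 0 < c) (hE : 0 < E)
    (hεA : 2 * (L * ε ^ 2) ≤ A) (hX1 : ∀ i, |X i| ≤ |h i| / α) (hX2 : ∀ i, |X i| < A → X i = h i / α)
    (hp : c * ε ^ 2 ≤ p) (hq : q ≤ D * ε ^ 2)
    (h1 : (∑ i, |X i|) / N - M = z1) (h2 : (∑ i, X i ^ 2) / N - E = z2)
    (h3 : (∑ i, Set.indicator {t : ℝ | |t| < α * (L * ε ^ 2) / 2} (fun _ => (1 : ℝ)) (h i)) / N - p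
      = z3)
    (h4 : (∑ i, Set.indicator {t : ℝ | |t| < α * (2 * (L * ε ^ 2))} (fun _ => (1 : ℝ)) (h i)) / N -
      q = z4)
    (hx : ¬ IsTypical M (√E) (κ + 1) (κ + 1 / √E) (c / 2) (D + c) L ε N x) :
    κ ^ 2 * ε ^ 6 - κ ^ 2 * (1 + (4 / c) ^ 2) * (z1 ^ 2 + z2 ^ 2 + z3 ^ 2 + z4 ^ 2) ≤
      (∑ i, (x i - X i) ^ 2) / N := by
  have hw0 : 0 ≤ (∑ i, (x i - X i) ^ 2) / N := by positivity
  have hk : 0 < κ ^ 2 := by positivity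
  have hc2 : 0 ≤ (4 / c) ^ 2 := by positivity
  have hp3 : ε ^ 3 ≤ ε ^ 2 := pow_le_pow_of_le_one hε.le hε1.le (by norm_num)
  have hc4 : ε ^ 3 ≤ 4 / c * (c / 4 * ε ^ 2) := by
    rw [← mul_assoc, show 4 / c * (c / 4) = 1 by field_simp]
    linarith
  have key : ε ^ 6 ≤ (1 + (4 / c) ^ 2) * (z1 ^ 2 + z2 ^ 2 + z3 ^ 2 + z4 ^ 2) →
      κ ^ 2 * ε ^ 6 - κ ^ 2 * (1 + (4 / c) ^ 2) * (z1 ^ 2 + z2 ^ 2 + z3 ^ 2 + z4 ^ 2) ≤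
      (∑ i, (x i - X i) ^ 2) / N := fun hh => by
    have := mul_le_mul_of_nonneg_left hh hk.le
    linarith
  have s1 := sq_nonneg z1
  have s2 := sq_nonneg z2
  have s3 := sq_nonneg z3
  have s4 := sq_nonneg z4
  have p1 := mul_nonneg hc2 (sq_nonneg z1)
  have p2 := mul_nonneg hc2 (sq_nonneg z2)
  have p3 := mul_nonneg hc2 (sq_nonneg z3)
  have p4 := mul_nonneg hc2 (sq_nonneg z4)
  by_cases c1 : |z1| ≤ ε ^ 3
  swap
  · have := le_mul_sq_of_lt_abs (a := 1) zero_le_one hε (by simp) (not_le.1 c1)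
    refine key ?_
    linarith
  by_cases c2 : |z2| ≤ ε ^ 3
  swap
  · have := le_mul_sq_of_lt_abs (a := 1) zero_le_one hε (by simp) (not_le.1 c2)
    refine key ?_
    linarith
  by_cases c3 : |z3| ≤ c / 4 * ε ^ 2
  swap
  · have := le_mul_sq_of_lt_abs (a := 4 / c) (by positivity) hε hc4 (not_le.1 c3)
    refine key ?_
    linarith
  by_cases c4 : |z4| ≤ c / 4 * ε ^ 2
  swap
  · have := le_mul_sq_of_lt_abs (a := 4 / c) (by positivity) hε hc4 (not_le.1 c4)
    refine key ?_
    linarith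
  by_cases c5 : (∑ i, (x i - X i) ^ 2) / N ≤ κ ^ 2 * ε ^ 6
  · exact absurd (statistics_of_close hN hN0 hα hL hε hκ hκc hc hE hεA hX1 hX2 hp hq c5
      (by rwa [h1]) (by rwa [h2])
      (by rwa [h3]) (by rwa [h4])) hx
  · have : 0 ≤ κ ^ 2 * (1 + (4 / c) ^ 2) * (z1 ^ 2 + z2 ^ 2 + z3 ^ 2 + z4 ^ 2) := by positivity
    linarith [not_le.1 c5]

/-- The value of the auxiliary objective outside the typical set exceeds the scalar value by a
multiple of `ε ^ 6`, up to empirical fluctuations `z₁, …, z₇`. -/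
lemma auxiliary_objective_ge_of_not_isTypical {I J : Type*} [Fintype I] [Fintype J] {s g : J → ℝ}
    {h x : I → ℝ} {δ lam A τ β L N ε κ c D M E Q p q z1 z2 z3 z4 z5 z6 z7 : ℝ}
    (hs : ∀ k, s k ^ 2 = 1) (hN : (Fintype.card I : ℝ) = N) (hN0 : 0 < N)
    (hm : (Fintype.card J : ℝ) = δ * N) (hδ : 0 < δ) (hlam : 0 ≤ lam) (hA : 0 < A) (hτ : 0 < τ)
    (hβ : 0 < β) (hE : δ * τ ^ 2 = 1 + E) (hE0 : 0 < E) (hEA : E ≤ A ^ 2) (hx : ∀ i, |x i| ≤ A)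
    (hL : 0 < L) (hε : 0 < ε) (hε1 : ε < 1)
    (hκ : 0 < κ) (hκc : κ ^ 2 = c * L ^ 2 / 16) (hc : 0 < c) (hεA : 2 * (L * ε ^ 2) ≤ A)
    (hp : c * ε ^ 2 ≤ p) (hq : q ≤ D * ε ^ 2)
    (h1 : (∑ i, |Xstar lam A τ β (h i)|) / N - M = z1)
    (h2 : (∑ i, Xstar lam A τ β (h i) ^ 2) / N - E = z2)
    (h3 : (∑ i, Set.indicator {t : ℝ | |t| < (1 / τ + 2 * lam / β) * (L * ε ^ 2) / 2}
      (fun _ => (1 : ℝ)) (h i)) / N - p = z3)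
    (h4 : (∑ i, Set.indicator {t : ℝ | |t| < (1 / τ + 2 * lam / β) * (2 * (L * ε ^ 2))}
      (fun _ => (1 : ℝ)) (h i)) / N - q = z4)
    (h5 : (∑ i, h i * Xstar lam A τ β (h i)) / N - Q = z5)
    (h6 : (∑ l, g l ^ 2) / N - δ = z6) (h7 : (∑ l, g l * s l) / N = z7)
    (hxt : ¬ IsTypical M (√E) (κ + 1) (κ + 1 / √E) (c / 2) (D + c) L ε N x) :
    β / τ + (β / τ + lam) * E - β * Q + β / (2 * (1 + A ^ 2) * τ) * κ ^ 2 * ε ^ 6 -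
      (β / τ + lam + β * √δ * (1 + A ^ 2) / 2 + β + β / √δ * (A ^ 2 + 2 * A) +
        β / (2 * (1 + A ^ 2) * τ) * κ ^ 2 * (1 + (4 / c) ^ 2)) *
        (|z2| + |z5| + |z6| + |z7| + (z1 ^ 2 + z2 ^ 2 + z3 ^ 2 + z4 ^ 2)) ≤
      β / √N * (√(∑ l, (√(∑ i, (x i / √N) ^ 2) * g l - s l) ^ 2) - ∑ i, x i / √N * h i) +
        lam * ∑ i, (x i / √N) ^ 2 := by
  have hα : 0 < 1 / τ + 2 * lam / β := by positivity
  have hw := sq_dist_ge_of_not_isTypical (x := x) (X := fun i => Xstar lam A τ β (h i)) hN hN0 hα hL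
    hε hε1 hκ hκc hc hE0 hεA (fun i => abs_Xstar_le_div hα hA _) (fun i => Xstar_eq_div hA)
    hp hq h1 h2 h3 h4 hxt
  refine le_trans ?_ (auxiliary_objective_ge hs hN hN0 hm hδ hlam hA hτ hβ hE hE0.le hEA hx)
  rw [h2, h6, h7]
  generalize (∑ i, (x i - Xstar lam A τ β (h i)) ^ 2) / N = w at hw ⊢
  rw [show (∑ i, Xstar lam A τ β (h i) ^ 2) / N = E + z2 by linarith,
    show (∑ i, h i * Xstar lam A τ β (h i)) / N = Q + z5 by linarith]
  set S := z1 ^ 2 + z2 ^ 2 + z3 ^ 2 + z4 ^ 2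
  have hS : 0 ≤ S := by positivity
  set K0 := β / τ + lam
  have hK0 : 0 ≤ K0 := by positivity
  set K1 := β * √δ * (1 + A ^ 2) / 2
  have hK1 : 0 ≤ K1 := by positivity
  set K2 := β / √δ
  have hK2 : 0 ≤ K2 := by positivity
  set μ := β / (2 * (1 + A ^ 2) * τ)
  have hμ : 0 ≤ μ := by positivity
  set c4 := κ ^ 2 * (1 + (4 / c) ^ 2)
  have hc4 : 0 ≤ c4 := by positivity
  have w1 := mul_le_mul_of_nonneg_left hw hμ
  have e1 : μ * κ ^ 2 * (1 + (4 / c) ^ 2) = μ * c4 := by simp only [c4]; ring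
  rw [e1]
  have a2 : -|z2| * K0 ≤ K0 * z2 := by
    linarith [mul_le_mul_of_nonneg_left (neg_abs_le z2) hK0]
  have a5 : β * z5 ≤ β * |z5| := mul_le_mul_of_nonneg_left (le_abs_self z5) hβ.le
  have n2 := abs_nonneg z2
  have n5 := abs_nonneg z5
  have n6 := abs_nonneg z6
  have n7 := abs_nonneg z7
  have hA2 : 0 ≤ A ^ 2 := by positivity
  have hμc : 0 ≤ μ * c4 := by positivity
  have b1 : 0 ≤ (K0 + K1) * (|z5| + |z6| + |z7| + S) := by positivity
  have b2 : 0 ≤ β * (|z2| + |z6| + |z7| + S) := by positivity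
  have b3 : 0 ≤ K2 * A ^ 2 * (|z2| + |z5| + |z7| + S) := by positivity
  have b4 : 0 ≤ K2 * (2 * A) * (|z2| + |z5| + |z6| + S) := by positivity
  have b5 : 0 ≤ μ * c4 * (|z2| + |z5| + |z6| + |z7|) := by positivity
  linarith

end LowerBound

section ExpectedValue

lemma memLp_two_gaussian_of_bounded {f : ℝ → ℝ} {B : ℝ}
    (hf : AEStronglyMeasurable f (gaussianReal 0 1)) (h : ∀ t, |f t| ≤ B) :
    MemLp f 2 (gaussianReal 0 1) ∧ ∫ t, f t ^ 2 ∂(gaussianReal 0 1) ≤ B ^ 2 := by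
  have h1 : MemLp f 2 (gaussianReal 0 1) := MemLp.of_bound hf B (ae_of_all _ h)
  refine ⟨h1, ?_⟩
  calc ∫ t, f t ^ 2 ∂(gaussianReal 0 1) ≤ ∫ _t, B ^ 2 ∂(gaussianReal 0 1) :=
        integral_mono h1.integrable_sq (integrable_const _) fun t => sq_le_sq' (abs_le.1 (h t)).1
          (abs_le.1 (h t)).2
    _ = B ^ 2 := by simp

lemma memLp_two_mul_of_bounded {f : ℝ → ℝ} {B : ℝ}
    (hf : AEStronglyMeasurable f (gaussianReal 0 1)) (h : ∀ t, |f t| ≤ B) :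
    MemLp (fun t => t * f t) 2 (gaussianReal 0 1) ∧
      ∫ t, (t * f t) ^ 2 ∂(gaussianReal 0 1) ≤ B ^ 2 := by
  have h0 : MemLp (fun t : ℝ => t) 2 (gaussianReal 0 1) := memLp_id_gaussianReal' 2 (by norm_num)
  have h1 : MemLp (fun t => t * f t) 2 (gaussianReal 0 1) := by
    refine MemLp.of_le_mul (g := fun t : ℝ => t) (c := B) h0 (by fun_prop) (ae_of_all _ fun t => ?_)
    rw [norm_mul, mul_comm]
    exact mul_le_mul_of_nonneg_right (h t) (norm_nonneg _)
  refine ⟨h1, ?_⟩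
  calc ∫ t, (t * f t) ^ 2 ∂(gaussianReal 0 1) ≤ ∫ t, B ^ 2 * t ^ 2 ∂(gaussianReal 0 1) := by
        refine integral_mono h1.integrable_sq (h0.integrable_sq.const_mul _) fun t => ?_
        have := sq_le_sq' (abs_le.1 (h t)).1 (abs_le.1 (h t)).2
        dsimp only
        rw [mul_pow, mul_comm]
        exact mul_le_mul_of_nonneg_right this (sq_nonneg t)
    _ = B ^ 2 := by rw [integral_const_mul, gaussianReal_integral_sq, mul_one]

lemma memLp_two_sq_gaussian : MemLp (fun t : ℝ => t ^ 2) 2 (gaussianReal 0 1) := by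
  have h := (memLp_id_gaussianReal' (μ := 0) (v := 1) 4 (by norm_num))
  refine (memLp_two_iff_integrable_sq (by fun_prop)).2 ?_
  have := h.integrable_norm_pow (by norm_num)
  refine this.congr (ae_of_all _ fun t => ?_)
  simp only [id, norm_eq_abs]
  rw [← pow_mul]
  exact (Even.pow_abs (by decide) t)

variable {ι κ : Type*} [Fintype ι] [Fintype κ]

lemma isFluctuation_average_const {e : κ → ι} (he : Function.Injective e) {f : ℝ → ℝ} {C N : ℝ}
    (hN : 0 < N) (hC : 0 ≤ C) (hr : (Fintype.card κ : ℝ) = N)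
    (hf : MemLp f 2 (gaussianReal 0 1)) (h2 : ∫ t, f t ^ 2 ∂(gaussianReal 0 1) ≤ C) :
    IsFluctuation (stdPi ι) (fun ω => (∑ k, f (ω (e k))) / N - ∫ t, f t ∂(gaussianReal 0 1))
      C N := by
  have := isFluctuation_average (r := 1) (f := fun _ => f) (a := ∫ t, f t ∂(gaussianReal 0 1)) he hN
    hC (by rw [hr, one_mul]) (fun _ => hf) (fun _ => h2) (by simp [hr, mul_comm])
  rwa [one_mul] at this

lemma integral_sub_fluctuation_ge {Ω : Type*} [MeasurableSpace Ω] {μ : Measure Ω}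
    [IsProbabilityMeasure μ] {z1 z2 z3 z4 z5 z6 z7 : Ω → ℝ} {C N K a : ℝ} (hC : 0 ≤ C)
    (hN : 1 ≤ N) (hK : 0 ≤ K)
    (h1 : IsFluctuation μ z1 C N) (h2 : IsFluctuation μ z2 C N) (h3 : IsFluctuation μ z3 C N)
    (h4 : IsFluctuation μ z4 C N) (h5 : IsFluctuation μ z5 C N) (h6 : IsFluctuation μ z6 C N)
    (h7 : IsFluctuation μ z7 C N) :
    Integrable (fun ω => a - K * (|z2 ω| + |z5 ω| + |z6 ω| + |z7 ω| +
      (z1 ω ^ 2 + z2 ω ^ 2 + z3 ω ^ 2 + z4 ω ^ 2))) μ ∧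
    a - K * 8 * (C + 1) / √N ≤ ∫ ω, (a - K * (|z2 ω| + |z5 ω| + |z6 ω| + |z7 ω| +
      (z1 ω ^ 2 + z2 ω ^ 2 + z3 ω ^ 2 + z4 ω ^ 2))) ∂μ := by
  have i1 : Integrable (fun ω => |z2 ω| + |z5 ω|) μ := h2.3.add h5.3
  have i2 : Integrable (fun ω => |z2 ω| + |z5 ω| + |z6 ω|) μ := i1.add h6.3
  have i3 : Integrable (fun ω => |z2 ω| + |z5 ω| + |z6 ω| + |z7 ω|) μ := i2.add h7.3
  have j1 : Integrable (fun ω => z1 ω ^ 2 + z2 ω ^ 2) μ := h1.1.add h2.1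
  have j2 : Integrable (fun ω => z1 ω ^ 2 + z2 ω ^ 2 + z3 ω ^ 2) μ := j1.add h3.1
  have j3 : Integrable (fun ω => z1 ω ^ 2 + z2 ω ^ 2 + z3 ω ^ 2 + z4 ω ^ 2) μ := j2.add h4.1
  have hi : Integrable (fun ω => |z2 ω| + |z5 ω| + |z6 ω| + |z7 ω| +
      (z1 ω ^ 2 + z2 ω ^ 2 + z3 ω ^ 2 + z4 ω ^ 2)) μ := i3.add j3
  refine ⟨(integrable_const a).sub (hi.const_mul K), ?_⟩
  rw [integral_sub (integrable_const a) (hi.const_mul K), integral_const_mul]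
  have e : ∫ ω, (|z2 ω| + |z5 ω| + |z6 ω| + |z7 ω| +
      (z1 ω ^ 2 + z2 ω ^ 2 + z3 ω ^ 2 + z4 ω ^ 2)) ∂μ =
      (∫ ω, |z2 ω| ∂μ) + (∫ ω, |z5 ω| ∂μ) + (∫ ω, |z6 ω| ∂μ) + (∫ ω, |z7 ω| ∂μ) +
      ((∫ ω, z1 ω ^ 2 ∂μ) + (∫ ω, z2 ω ^ 2 ∂μ) + (∫ ω, z3 ω ^ 2 ∂μ) + ∫ ω, z4 ω ^ 2 ∂μ) := by
    rw [integral_add i3 j3, integral_add i2 h7.3, integral_add i1 h6.3, integral_add h2.3 h5.3,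
      integral_add j2 h4.1, integral_add j1 h3.1, integral_add h1.1 h2.1]
  have hs : √N ≤ N := by
    rw [sqrt_le_left (by linarith)]
    nlinarith
  have hs0 : 0 < √N := sqrt_pos.2 (by linarith)
  have hCN : C / N ≤ (C + 1) / √N := div_le_div₀ (by linarith) (by linarith) hs0 hs
  rw [e]
  have hb : (∫ ω, |z2 ω| ∂μ) + (∫ ω, |z5 ω| ∂μ) + (∫ ω, |z6 ω| ∂μ) + (∫ ω, |z7 ω| ∂μ) +
      ((∫ ω, z1 ω ^ 2 ∂μ) + (∫ ω, z2 ω ^ 2 ∂μ) + (∫ ω, z3 ω ^ 2 ∂μ) + ∫ ω, z4 ω ^ 2 ∂μ) ≤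
      8 * ((C + 1) / √N) := by
    linarith [h1.2, h2.2, h3.2, h4.2, h2.4, h5.4, h6.4, h7.4]
  have := mul_le_mul_of_nonneg_left hb hK
  simp only [integral_const, probReal_univ, one_smul]
  calc a - K * 8 * (C + 1) / √N = a - K * (8 * ((C + 1) / √N)) := by ring
    _ ≤ _ := by linarith

end ExpectedValue

section ExpectedValueOutside

lemma abs_indicator_le_one (a t : ℝ) :
    |Set.indicator {t : ℝ | |t| < a} (fun _ => (1 : ℝ)) t| ≤ 1 := by
  by_cases h : t ∈ {t : ℝ | |t| < a} <;> simp [h]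

lemma measurableSet_abs_lt (a : ℝ) : MeasurableSet {t : ℝ | |t| < a} :=
  measurableSet_lt (by fun_prop) measurable_const

lemma isFluctuation_indicator {ι κ : Type*} [Fintype ι] [Fintype κ] {e : κ → ι}
    (he : Function.Injective e) {N : ℝ} (hN : 0 < N) (hr : (Fintype.card κ : ℝ) = N) (a : ℝ) :
    IsFluctuation (stdPi ι) (fun ω =>
      (∑ k, Set.indicator {t : ℝ | |t| < a} (fun _ => (1 : ℝ)) (ω (e k))) / N -
        (gaussianReal 0 1).real {t : ℝ | |t| < a}) 1 N := by
  have hm := measurableSet_abs_lt a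
  have h := memLp_two_gaussian_of_bounded (B := 1)
    (f := Set.indicator {t : ℝ | |t| < a} (fun _ => (1 : ℝ)))
    (measurable_const.indicator hm).aestronglyMeasurable (abs_indicator_le_one a)
  have := isFluctuation_average_const he hN zero_le_one hr h.1 (h.2.trans (by norm_num))
  rwa [integral_indicator_const _ hm, smul_eq_mul, mul_one] at this

set_option maxHeartbeats 1000000 in
/-- The expected value of the primary optimization over points outside the typical set. -/
theorem exists_integral_minMax_ge {δ lam A L τ β : ℝ} (hδ : 0 < δ) (hlam : 0 ≤ lam) (hA : 0 < A)
    (hL : 0 < L) (hsaddle : IsSaddle δ lam 1 A τ β) :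
    ∃ Cx1 Cx2 Cl Cu ν K ε₀ : ℝ, 0 < Cx1 ∧ 0 < Cx2 ∧ 0 < Cl ∧ 0 < Cu ∧ 0 < ν ∧ 0 ≤ K ∧ 0 < ε₀ ∧
      ε₀ < 1 ∧ ∀ n m : ℕ, 0 < n → (m : ℝ) = δ * n → ∀ s : Fin m → ℝ, (∀ k, s k = 1 ∨ s k = -1) →
      ∀ ε, 0 < ε → ε < ε₀ → ∀ (κ : Type) [Fintype κ] [Nonempty κ] (x : κ → Fin n → ℝ),
      (∀ j i, |x j i| ≤ A) →
      (∀ j, ¬ IsTypical (∫ h, |Xstar lam A τ β h| ∂(gaussianReal 0 1)) (√(δ * τ ^ 2 - 1))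
        Cx1 Cx2 Cl Cu L ε n (x j)) →
      ∀ k : ℝ, 0 < k →
      phiFn δ lam 1 A τ β + β ^ 2 / 4 + ν * ε ^ 6 - K / √n - log (Fintype.card κ) / k ≤
        ∫ ω, minMax k (β / √n) (fun j => lam * ∑ i, (x j i / √n) ^ 2) s
          (matField fun j i => x j i / √n) 0 ω ∂(stdPi (Fin m × Fin n)) := by
  have hτ := hsaddle.1
  have hβ := hsaddle.2.1
  have hα : 0 < 1 / τ + 2 * lam / β := by positivity
  have hE := saddle_stationary hδ hlam hA hsaddle
  have hV := saddle_value hδ hlam hA hsaddle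
  have hE0 := Xstar_sq_integral_pos (lam := lam) (τ := τ) (β := β) hA hα
  have hXA : ∀ h, |Xstar lam A τ β h| ≤ A := fun h => abs_Xstar_le hA h
  have hXm : Continuous (Xstar lam A τ β) := continuous_Xstar
  have hEA : ∫ h, Xstar lam A τ β h ^ 2 ∂(gaussianReal 0 1) ≤ A ^ 2 :=
    (memLp_two_gaussian_of_bounded hXm.aestronglyMeasurable hXA).2
  rw [show δ * τ ^ 2 - 1 = ∫ h, Xstar lam A τ β h ^ 2 ∂(gaussianReal 0 1) by linarith, hV]
  set E := ∫ h, Xstar lam A τ β h ^ 2 ∂(gaussianReal 0 1) with hEdef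
  set Q := ∫ h, h * Xstar lam A τ β h ∂(gaussianReal 0 1) with hQdef
  set M := ∫ h, |Xstar lam A τ β h| ∂(gaussianReal 0 1) with hMdef
  set α := 1 / τ + 2 * lam / β with hαdef
  set d := gaussianPDFReal 0 1 1 with hd
  have hd0 : 0 < d := gaussianPDFReal_pos _ _ _ one_ne_zero
  set c := α * L * d with hcdef
  have hc : 0 < c := by positivity
  set κ₀ := √c * L / 4 with hκdef
  have hκ : 0 < κ₀ := by positivity
  have hκc : κ₀ ^ 2 = c * L ^ 2 / 16 := by
    rw [hκdef, div_pow, mul_pow, sq_sqrt hc.le]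
    norm_num
  set C4 := ∫ t, (t ^ 2) ^ 2 ∂(gaussianReal 0 1) with hC4
  have hC40 : 0 ≤ C4 := integral_nonneg fun t => by positivity
  set C := (1 + δ) * (A ^ 2 + (A ^ 2) ^ 2 + 1 + C4) with hC
  have hC0 : 0 ≤ C := by positivity
  have hCA : A ^ 2 ≤ C := by
    have : 0 ≤ δ * (A ^ 2 + (A ^ 2) ^ 2 + 1 + C4) + (A ^ 2) ^ 2 + 1 + C4 := by positivity
    linarith
  have hCA2 : (A ^ 2) ^ 2 ≤ C := by
    have : 0 ≤ δ * (A ^ 2 + (A ^ 2) ^ 2 + 1 + C4) + A ^ 2 + 1 + C4 := by positivity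
    linarith
  have hC1 : 1 ≤ C := by
    have : 0 ≤ δ * (A ^ 2 + (A ^ 2) ^ 2 + 1 + C4) + (A ^ 2) ^ 2 + A ^ 2 + C4 := by positivity
    linarith
  have hCδ : δ * 1 ≤ C := by
    have : 0 ≤ δ * (A ^ 2 + (A ^ 2) ^ 2 + C4) + (A ^ 2 + (A ^ 2) ^ 2 + 1 + C4) := by positivity
    linarith
  have hC4' : δ * C4 ≤ C := by
    have : 0 ≤ δ * (A ^ 2 + (A ^ 2) ^ 2 + 1) + (A ^ 2 + (A ^ 2) ^ 2 + 1 + C4) := by positivity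
    linarith
  set K := β / τ + lam + β * √δ * (1 + A ^ 2) / 2 + β + β / √δ * (A ^ 2 + 2 * A) +
        β / (2 * (1 + A ^ 2) * τ) * κ₀ ^ 2 * (1 + (4 / c) ^ 2) with hK
  have hK0 : 0 ≤ K := by positivity
  refine ⟨κ₀ + 1, κ₀ + 1 / √E, c / 2, 4 * α * L + c, β / (2 * (1 + A ^ 2) * τ) * κ₀ ^ 2,
    K * 8 * (C + 1) + β * A, min (1 / 2) (min (A / (2 * L)) (2 / (α * L))), by positivity,
    by positivity, by positivity, by positivity, by positivity, by positivity, by positivity,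
    (min_le_left _ _).trans_lt (by norm_num), ?_⟩
  intro n m hn hm s hs ε hε hεlt κ _ _ x hx hxt k hk
  have hε1 : ε < 1 := hεlt.trans_le ((min_le_left _ _).trans (by norm_num))
  have hεsq : ε ^ 2 ≤ ε := by
    rw [sq]
    exact mul_le_of_le_one_left hε.le hε1.le
  have hεA : 2 * (L * ε ^ 2) ≤ A := by
    have h1 : ε ≤ A / (2 * L) := hεlt.le.trans ((min_le_right _ _).trans (min_le_left _ _))
    rw [le_div_iff₀ (by positivity)] at h1
    have : 2 * L * ε ^ 2 ≤ 2 * L * ε := mul_le_mul_of_nonneg_left hεsq (by positivity)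
    linarith
  have hεα : α * (L * ε ^ 2) / 2 ≤ 1 := by
    have h1 : ε ≤ 2 / (α * L) := hεlt.le.trans ((min_le_right _ _).trans (min_le_right _ _))
    rw [le_div_iff₀ (by positivity)] at h1
    have : α * L * ε ^ 2 ≤ α * L * ε := mul_le_mul_of_nonneg_left hεsq (by positivity)
    linarith
  set N : ℝ := (n : ℝ) with hNdef
  have hN0 : 0 < N := Nat.cast_pos.2 hn
  have hN1 : 1 ≤ N := Nat.one_le_cast.2 hn
  have hI : (Fintype.card (Fin n) : ℝ) = N := by simp [hNdef]
  have hJ : (Fintype.card (Fin m) : ℝ) = δ * N := by simpa using hm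
  have hs2 : ∀ l, s l ^ 2 = 1 := fun l => by rcases hs l with h | h <;> rw [h] <;> norm_num
  have hr : Function.Injective (Sum.inr : Fin n → Fin m ⊕ Fin n) := Sum.inr_injective
  have hl : Function.Injective (Sum.inl : Fin m → Fin m ⊕ Fin n) := Sum.inl_injective
  have f1 := (isFluctuation_average_const hr hN0 (by positivity) hI
    (memLp_two_gaussian_of_bounded (f := fun t => |Xstar lam A τ β t|) (B := A)
      hXm.abs.aestronglyMeasurable fun t => by rw [abs_abs]; exact hXA t).1
    (memLp_two_gaussian_of_bounded (f := fun t => |Xstar lam A τ β t|) (B := A)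
      hXm.abs.aestronglyMeasurable fun t => by rw [abs_abs]; exact hXA t).2).mono hN0 hCA
  have hX2 : ∀ t, |Xstar lam A τ β t ^ 2| ≤ A ^ 2 := fun t => by
    rw [abs_pow]
    exact pow_le_pow_left₀ (abs_nonneg _) (hXA t) 2
  have g2 := memLp_two_gaussian_of_bounded (f := fun t => Xstar lam A τ β t ^ 2)
    (hXm.pow 2).aestronglyMeasurable hX2
  have f2 := (isFluctuation_average_const hr hN0 (by positivity) hI g2.1 g2.2).mono hN0 hCA2
  have f3 := (isFluctuation_indicator hr hN0 hI (α * (L * ε ^ 2) / 2)).mono hN0 hC1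
  have f4 := (isFluctuation_indicator hr hN0 hI (α * (2 * (L * ε ^ 2)))).mono hN0 hC1
  have g5 := memLp_two_mul_of_bounded hXm.aestronglyMeasurable hXA
  have f5 := (isFluctuation_average_const hr hN0 (by positivity) hI g5.1 g5.2).mono hN0 hCA
  have f6 := (isFluctuation_average (f := fun _ t => t ^ 2) (a := δ) hl hN0 hC40 hJ.le
    (fun _ => memLp_two_sq_gaussian) (fun _ => le_rfl)
    (by simp [gaussianReal_integral_sq, ← hm])).mono hN0 hC4'
  have g7 : ∀ l, MemLp (fun t : ℝ => t * s l) 2 (gaussianReal 0 1) ∧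
      ∫ t, (t * s l) ^ 2 ∂(gaussianReal 0 1) ≤ 1 ^ 2 := fun l =>
    memLp_two_mul_of_bounded (f := fun _ => s l) (by fun_prop) fun _ => by
      rcases hs l with h | h <;> rw [h] <;> norm_num
  have f7 := (isFluctuation_average (f := fun l t => t * s l) (a := 0) (C := 1) hl hN0 zero_le_one
    hJ.le (fun l => (g7 l).1) (fun l => (g7 l).2.trans (by norm_num))
    (by simp [integral_mul_const, integral_id_gaussianReal])).mono hN0 hCδ
  simp only [sub_zero] at f7
  obtain ⟨hGi, hGe⟩ := integral_sub_fluctuation_ge (K := K)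
    (a := β / τ + (β / τ + lam) * E - β * Q + β / (2 * (1 + A ^ 2) * τ) * κ₀ ^ 2 * ε ^ 6)
    hC0 hN1 hK0 f1 f2 f3 f4 f5 f6 f7
  have hp : c * ε ^ 2 ≤ (gaussianReal 0 1).real {t : ℝ | |t| < α * (L * ε ^ 2) / 2} := by
    refine le_trans (le_of_eq ?_) (gaussianReal_real_abs_lt_ge (by positivity) hεα)
    rw [hcdef, hd]
    ring
  have hq : (gaussianReal 0 1).real {t : ℝ | |t| < α * (2 * (L * ε ^ 2))} ≤
      4 * α * L * ε ^ 2 := by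
    refine (gaussianReal_real_abs_lt_le (by positivity)).trans (le_of_eq ?_)
    ring
  have hR : ∀ j, √(∑ i, (x j i / √N) ^ 2) ≤ A := fun j => by
    refine sqrt_le_iff.2 ⟨hA.le, ?_⟩
    calc ∑ i, (x j i / √N) ^ 2 ≤ ∑ _i : Fin n, A ^ 2 / N := by
          refine Finset.sum_le_sum fun i _ => ?_
          rw [div_pow, sq_sqrt hN0.le]
          exact div_le_div_of_nonneg_right (sq_le_sq' (abs_le.1 (hx j i)).1 (abs_le.1 (hx j i)).2)
            hN0.le
      _ = A ^ 2 := by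
        rw [Finset.sum_const, Finset.card_univ, nsmul_eq_mul, hI]
        field_simp
  have hfin := integral_minMax_matField_ge (b := β / √N) (s := s)
    (y := fun j i => x j i / √N) (ψ := fun j => lam * ∑ i, (x j i / √N) ^ 2) hk
    (by positivity) hR hGi fun j ω =>
    auxiliary_objective_ge_of_not_isTypical (g := fun l => ω (Sum.inl l))
      (h := fun i => ω (Sum.inr i)) hs2 hI hN0 hJ hδ hlam hA hτ hβ hE hE0 hEA (hx j) hL hε hε1 hκ
      hκc hc hεA hp hq rfl rfl rfl rfl rfl rfl rfl (hxt j)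
  refine le_trans ?_ hfin
  rw [add_div, show β * A / √N = β / √N * A by ring]
  linarith

end ExpectedValueOutside

section Conclusion

variable {m n : ℕ}

lemma matMeasure_measurePreserving (hn : 0 < n) :
    MeasurePreserving (fun (H : Fin m → Fin n → ℝ) (p : Fin m × Fin n) => √n * H p.1 p.2)
      (matMeasure m n) (stdPi (Fin m × Fin n)) := by
  have hm : Measurable (fun (H : Fin m → Fin n → ℝ) (p : Fin m × Fin n) => √n * H p.1 p.2) := by
    fun_prop
  refine ⟨hm, (Measure.pi_eq fun t ht => ?_).symm⟩
  rw [Measure.map_apply hm (MeasurableSet.univ_pi ht)]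
  have e : (fun (H : Fin m → Fin n → ℝ) (p : Fin m × Fin n) => √n * H p.1 p.2) ⁻¹' Set.univ.pi t =
      Set.univ.pi fun l => Set.univ.pi fun i => (fun a : ℝ => √n * a) ⁻¹' t (l, i) := by
    ext H
    simp
  rw [e, matMeasure, Measure.pi_pi, Fintype.prod_prod_type]
  refine Finset.prod_congr rfl fun l _ => ?_
  rw [Measure.pi_pi]
  refine Finset.prod_congr rfl fun i _ => ?_
  rw [← Measure.map_apply (by fun_prop) (ht _), gaussianReal_map_const_mul, mul_zero]
  congr 2
  ext
  have : (0 : ℝ) < n := Nat.cast_pos.2 hn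
  simp [this.ne']

lemma minMax_le_cost1 {κ : Type*} [Fintype κ] [Nonempty κ] {k lam β : ℝ} (hn : 0 < n) (hk : 0 < k) (hβ : 0 < β)
    (s : Fin m → ℝ) (x : κ → Fin n → ℝ) (H : Fin m → Fin n → ℝ) (j : κ) :
    minMax k (β / √n) (fun j => lam * ∑ i, (x j i / √n) ^ 2) s (matField fun j i => x j i / √n) 0
      (fun p => √n * H p.1 p.2) ≤ cost1 m n lam s H (x j) + β ^ 2 / 4 + β / √n := by
  have hN0 : (0 : ℝ) < n := Nat.cast_pos.2 hn
  have hs0 : 0 < √(n : ℝ) := sqrt_pos.2 hN0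
  refine (softMin_le hk _ j).trans ?_
  have e1 : ∀ l, affField (matField fun j i => x j i / √n) s (fun p => √n * H p.1 p.2) j l =
      mulV H (x j) l - s l := fun l => by
    unfold affField
    rw [sum_matField, mulV]
    congr 1
    refine Finset.sum_congr rfl fun i _ => ?_
    field_simp
  unfold energy
  have e2 : linField (0 : κ → Fin m × Fin n → ℝ) (fun p => √n * H p.1 p.2) j = 0 := by
    simp [linField]
  rw [e2, funext e1, add_zero]
  set v : Fin m → ℝ := fun l => mulV H (x j) l - s l with hv
  have h1 := smoothNorm_le v
  have h2 : (√(∑ l, v l ^ 2)) ^ 2 = ∑ l, v l ^ 2 := sq_sqrt (by positivity)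
  have h3 : (√(n : ℝ)) ^ 2 = n := sq_sqrt hN0.le
  have h4 : ∑ i, (x j i / √n) ^ 2 = (∑ i, x j i ^ 2) / n := by
    rw [Finset.sum_div]
    refine Finset.sum_congr rfl fun i _ => ?_
    rw [div_pow, h3]
  have h5 : cost1 m n lam s H (x j) = (√(∑ l, v l ^ 2) / √n) ^ 2 + lam * (∑ i, x j i ^ 2) / n := by
    rw [cost1, div_pow, h2, h3]
  beta_reduce
  rw [h4, h5]
  have h6 : β / √n * smoothNorm v ≤ β / √n * (√(∑ l, v l ^ 2) + 1) :=
    mul_le_mul_of_nonneg_left h1 (by positivity)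
  have h7 : β / √n * (√(∑ l, v l ^ 2) + 1) = β * (√(∑ l, v l ^ 2) / √n) + β / √n := by ring
  rw [mul_div_assoc]
  nlinarith [sq_nonneg (√(∑ l, v l ^ 2) / √n - β / 2)]

lemma continuous_cost1 (lam : ℝ) (s : Fin m → ℝ) (H : Fin m → Fin n → ℝ) :
    Continuous (cost1 m n lam s H) := by
  unfold cost1 mulV
  fun_prop

/-- A measure bound for an infimum of continuous functions follows from the corresponding bounds
over finite families. -/
lemma measure_exists_le_of_finite {Ω E : Type*} [MeasurableSpace Ω] {μ : Measure Ω}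
    [TopologicalSpace E] [SecondCountableTopology E] {S : Set E} {f : Ω → E → ℝ}
    (hf : ∀ ω, Continuous (f ω)) {a b : ℝ} (hab : a < b) {B : ℝ≥0∞}
    (h : ∀ (N : ℕ) (x : Fin (N + 1) → E), (∀ j, x j ∈ S) → μ {ω | ∃ j, f ω (x j) ≤ b} ≤ B) :
    μ {ω | ∃ x ∈ S, f ω x ≤ a} ≤ B := by
  rcases S.eq_empty_or_nonempty with rfl | hS
  · simp
  have : Nonempty S := hS.to_subtype
  obtain ⟨u, hu⟩ := TopologicalSpace.exists_dense_seq S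
  have hsub : {ω | ∃ x ∈ S, f ω x ≤ a} ⊆
      ⋃ N : ℕ, {ω | ∃ j : Fin (N + 1), f ω (u j) ≤ b} := by
    rintro ω ⟨x, hx, hxa⟩
    have ho : IsOpen {y : S | f ω y < b} :=
      isOpen_lt ((hf ω).comp continuous_subtype_val) continuous_const
    obtain ⟨N, hN⟩ := hu.exists_mem_open ho ⟨⟨x, hx⟩, hxa.trans_lt hab⟩
    refine Set.mem_iUnion.2 ⟨N, ⟨Fin.last N, ?_⟩⟩
    exact le_of_lt hN
  have hmono : Monotone fun N : ℕ => {ω | ∃ j : Fin (N + 1), f ω (u j) ≤ b} := by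
    rintro N N' hN ω ⟨j, hj⟩
    exact ⟨Fin.castLE (by omega) j, hj⟩
  refine (measure_mono hsub).trans ?_
  rw [hmono.measure_iUnion]
  exact iSup_le fun N => h N (fun j => u j) fun j => (u j).2

end Conclusion

/-- box-constrained vectors outside the concentration set `S°` cannot achieve
a cost within `γ ε⁶` of the optimum, except with probability at most
`(C/ε⁶) e^{−c n ε¹²}`.  The event `min ≤ t` over the constrained set is expressed as
`∃ x` feasible with `P(x; 1) ≤ t`. -/
theorem stmt19 (δ lam A L : ℝ) (hδ : 0 < δ) (hlam : 0 ≤ lam) (hA : 0 < A) (hL : 0 < L)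
    (hcond : 0 < lam ∨ (lam = 0 ∧ 1 ≤ δ))
    (τs βs : ℝ) (hsaddle : IsSaddle δ lam 1 A τs βs) :
    ∃ Cx1 Cx2 Cl Cu C c γ ε₀ : ℝ,
      0 < Cx1 ∧ 0 < Cx2 ∧ 0 < Cl ∧ 0 < Cu ∧ 0 < C ∧ 0 < c ∧ 0 < γ ∧ 0 < ε₀ ∧ ε₀ < 1 ∧
      ∀ (n m : ℕ), (m : ℝ) = δ * n →
        ∀ s : Fin m → ℝ, (∀ k, s k = 1 ∨ s k = -1) →
          ∀ ε : ℝ, 0 < ε → ε < ε₀ →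
            matMeasure m n
                {H : Fin m → Fin n → ℝ | ∃ x : Fin n → ℝ,
                  (∀ i, |x i| ≤ A) ∧
                  ¬((|(∑ i, |x i|) / n -
                        ∫ h : ℝ, |Xstar lam A τs βs h| ∂(gaussianReal 0 1)| ≤
                      Cx1 * ε ^ 3) ∧
                    (|Real.sqrt (∑ i, (x i) ^ 2) / Real.sqrt n -
                        Real.sqrt (δ * τs ^ 2 - 1)| ≤ Cx2 * ε ^ 3) ∧
                    (Cl * n * ε ^ 2 ≤
                        (Set.ncard {i : Fin n |
                          x i ∈ Set.Ioo (-(L * ε ^ 2)) (L * ε ^ 2)} : ℝ) ∧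
                      (Set.ncard {i : Fin n |
                          x i ∈ Set.Ioo (-(L * ε ^ 2)) (L * ε ^ 2)} : ℝ) ≤
                        Cu * n * ε ^ 2)) ∧
                  cost1 m n lam s H x ≤ phiFn δ lam 1 A τs βs + γ * ε ^ 6} ≤
              ENNReal.ofReal (C / ε ^ 6 * Real.exp (-c * n * ε ^ 12)) := by
  have hβ := hsaddle.2.1
  obtain ⟨Cx1, Cx2, Cl, Cu, ν, K, ε₀, hCx1, hCx2, hCl, hCu, hν, hK, hε₀, hε₀1, hmain⟩ :=
    exists_integral_minMax_ge hδ hlam hA hL hsaddle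
  set c := ν ^ 2 / (8 * π ^ 2 * βs ^ 2 * A ^ 2) with hc
  have hc0 : 0 < c := by positivity
  set T := 4 * (K + 1 + βs) / ν with hT
  have hT0 : 0 < T := by positivity
  refine ⟨Cx1, Cx2, Cl, Cu, exp (c * T ^ 2), c, ν / 4, ε₀, hCx1, hCx2, hCl, hCu, exp_pos _, hc0,
    by positivity, hε₀, hε₀1, ?_⟩
  intro n m hm s hs ε hε hεlt
  have hε1 : ε < 1 := hεlt.trans hε₀1
  have hε6 : 0 < ε ^ 6 := by positivity
  have hε61 : ε ^ 6 ≤ 1 := pow_le_one₀ hε.le hε1.le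
  have hexp : exp (c * T ^ 2 + -c * n * ε ^ 12) ≤ exp (c * T ^ 2) / ε ^ 6 * exp (-c * n * ε ^ 12) := by
    rw [exp_add]
    refine mul_le_mul_of_nonneg_right ?_ (exp_pos _).le
    rw [le_div_iff₀ hε6]
    exact mul_le_of_le_one_right (exp_pos _).le hε61
  rcases le_or_gt ((n : ℝ) * ε ^ 12) (T ^ 2) with hsmall | hlarge
  · have : IsProbabilityMeasure (matMeasure m n) := by
      unfold matMeasure
      infer_instance
    refine prob_le_one.trans ?_
    rw [← ENNReal.ofReal_one]
    refine ENNReal.ofReal_le_ofReal (le_trans ?_ hexp)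
    refine one_le_exp ?_
    have := mul_le_mul_of_nonneg_left hsmall hc0.le
    linarith
  have hn : 0 < n := by
    rcases Nat.eq_zero_or_pos n with h | h
    · subst h
      simp only [Nat.cast_zero, zero_mul] at hlarge
      linarith [sq_nonneg T]
    · exact h
  have hN0 : (0 : ℝ) < n := Nat.cast_pos.2 hn
  have hs0 : 0 < √(n : ℝ) := sqrt_pos.2 hN0
  have hsq : √(n : ℝ) ^ 2 = n := sq_sqrt hN0.le
  have hTn : T < √n * ε ^ 6 := by
    refine lt_of_pow_lt_pow_left₀ 2 (by positivity) ?_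
    rw [mul_pow, hsq]
    calc T ^ 2 < n * ε ^ 12 := hlarge
      _ = n * (ε ^ 6) ^ 2 := by ring
  have herr : (K + 1 + βs) / √n ≤ ν / 4 * ε ^ 6 := by
    rw [div_le_iff₀ hs0]
    rw [hT, div_lt_iff₀ hν] at hTn
    linarith
  set S : Set (Fin n → ℝ) := {x | (∀ i, |x i| ≤ A) ∧
    ¬ IsTypical (∫ h, |Xstar lam A τs βs h| ∂(gaussianReal 0 1)) (√(δ * τs ^ 2 - 1))
        Cx1 Cx2 Cl Cu L ε n x} with hS
  have hb : phiFn δ lam 1 A τs βs + ν / 4 * ε ^ 6 < phiFn δ lam 1 A τs βs + ν / 2 * ε ^ 6 := by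
    nlinarith
  refine le_trans (measure_mono ?_) (measure_exists_le_of_finite (μ := matMeasure m n) (S := S)
    (f := cost1 m n lam s) (fun H => continuous_cost1 lam s H) hb fun N x hx => ?_)
  · rintro H ⟨x, h1, h2, h3⟩
    exact ⟨x, ⟨h1, h2⟩, h3⟩
  set l := log (Fintype.card (Fin (N + 1))) with hl
  have hl0 : 0 ≤ l := log_natCast_nonneg _
  have hk : 0 < √(n : ℝ) * (l + 1) := by positivity
  have hlk : l / (√(n : ℝ) * (l + 1)) ≤ 1 / √n := by
    rw [div_le_div_iff₀ hk hs0]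
    nlinarith
  have hint := hmain n m hn hm s hs ε hε hεlt (Fin (N + 1)) x (fun j => (hx j).1)
    (fun j => (hx j).2) _ hk
  have hR : ∀ j, ∑ i, (x j i / √n) ^ 2 ≤ A ^ 2 := fun j => by
    calc ∑ i, (x j i / √n) ^ 2 ≤ ∑ _i : Fin n, A ^ 2 / n := by
          refine Finset.sum_le_sum fun i _ => ?_
          rw [div_pow, hsq]
          exact div_le_div_of_nonneg_right
            (sq_le_sq' (abs_le.1 ((hx j).1 i)).1 (abs_le.1 ((hx j).1 i)).2) hN0.le
      _ = A ^ 2 := by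
        rw [Finset.sum_const, Finset.card_univ, nsmul_eq_mul, Fintype.card_fin]
        field_simp
  have htail := minMax_matField_lower_tail (b := βs / √n) (s := s) (t := ν / 4 * ε ^ 6)
    (y := fun j i => x j i / √n) (ψ := fun j => lam * ∑ i, (x j i / √n) ^ 2) hk hR
    (by positivity) (by positivity) (by positivity)
  have hmp := matMeasure_measurePreserving (m := m) hn
  have hsub : {H | ∃ j, cost1 m n lam s H (x j) ≤ phiFn δ lam 1 A τs βs + ν / 2 * ε ^ 6} ⊆
      (fun (H : Fin m → Fin n → ℝ) (p : Fin m × Fin n) => √n * H p.1 p.2) ⁻¹'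
      {ω | minMax (√(n : ℝ) * (l + 1)) (βs / √n) (fun j => lam * ∑ i, (x j i / √n) ^ 2) s
        (matField fun j i => x j i / √n) 0 ω ≤
        ∫ η, minMax (√(n : ℝ) * (l + 1)) (βs / √n) (fun j => lam * ∑ i, (x j i / √n) ^ 2) s
        (matField fun j i => x j i / √n) 0 η ∂(stdPi (Fin m × Fin n)) - ν / 4 * ε ^ 6} := by
    rintro H ⟨j, hj⟩
    have h1 := minMax_le_cost1 (lam := lam) hn hk hβ s x H j
    refine h1.trans ?_
    rw [add_div, add_div] at herr
    linarith
  calc _ ≤ _ := measure_mono hsub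
    _ = _ := hmp.measure_preimage
        (measurableSet_le continuous_minMax.measurable measurable_const).nullMeasurableSet
    _ ≤ _ := htail
    _ ≤ _ := by
      refine ENNReal.ofReal_le_ofReal (le_trans (exp_le_exp.2 ?_) hexp)
      have e : 2 * (ν / 4 * ε ^ 6) ^ 2 / (π ^ 2 * ((βs / √n) ^ 2 * A ^ 2)) = c * n * ε ^ 12 := by
        rw [hc, div_pow, hsq]
        field_simp
        ring
      rw [e]
      have : 0 ≤ c * T ^ 2 := by positivity
      linarith
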